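/- Let f satisfy (H) with 0 < τ₋ ≤ τ₊ < 2, let α > 1 be such that P_f(α, τ₋, τ₊) < 0, and let (u_m) be a sequence of smooth positive solutions of (N_{λ_m}) on a smooth bounded domain Ω ⊂ ℝⁿ satisfying the stability inequality. Then sup_m ∫_Ω f̃(u_m)^{2α} / f'(u_m)^{α−1/2} dx < ∞, where f̃(t) = f(t) − f(0). -/

import Mathlib

open MeasureTheory Filter Topology Real Set

noncomputable section

/-- The Laplacian of a real-valued function on Euclidean space. -/
def lap {n : ℕ} (u : EuclideanSpace ℝ (Fin n) → ℝ) (x : EuclideanSpace ℝ (Fin n)) : ℝ :=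
  ∑ i : Fin n, iteratedFDeriv ℝ 2 u x ![EuclideanSpace.single i (1:ℝ), EuclideanSpace.single i (1:ℝ)]

/-- A bounded (smooth) domain. -/
def GoodDomain {n : ℕ} (Ω : Set (EuclideanSpace ℝ (Fin n))) : Prop :=
  IsOpen Ω ∧ Bornology.IsBounded Ω ∧ Ω.Nonempty

/-- The domain `[0, a_f)` of the nonlinearity. -/
def domf (a : EReal) : Set ℝ := {t : ℝ | 0 ≤ t ∧ (t : EReal) < a}

/-- The filter of `t → a_f⁻`. -/
def afFilter (a : EReal) : Filter ℝ :=
  if a = ⊤ then Filter.atTop else nhdsWithin a.toReal (Set.Iio a.toReal)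

/-- Hypothesis (H) on the nonlinearity `f : [0, a_f) → ℝ₊`. -/
structure HypH (a : EReal) (f : ℝ → ℝ) : Prop where
  a_pos : 0 < a
  smooth : ContDiffOn ℝ (⊤ : ℕ∞) f (domf a)
  mono : StrictMonoOn f (domf a)
  convex : ConvexOn ℝ (domf a) f
  f0_pos : 0 < f 0
  pos : ∀ t ∈ domf a, 0 < f t
  blowup : Filter.Tendsto f (afFilter a) Filter.atTop
  superlinear : a = ⊤ → Filter.Tendsto (fun t => f t / t) Filter.atTop Filter.atTop

/-- `τ₋ = liminf_{t → a_f} f f'' / (f')²`. -/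
def tauMinus (a : EReal) (f : ℝ → ℝ) : ℝ :=
  Filter.liminf (fun t => f t * deriv (deriv f) t / (deriv f t) ^ 2) (afFilter a)

/-- `τ₊ = limsup_{t → a_f} f f'' / (f')²`. -/
def tauPlus (a : EReal) (f : ℝ → ℝ) : ℝ :=
  Filter.limsup (fun t => f t * deriv (deriv f) t / (deriv f t) ^ 2) (afFilter a)

/-- `u` is a (smooth, `[0,a_f)`-valued) solution of `Δ²u = λ f(u)` in `Ω`,
`u = Δu = 0` on `∂Ω`. -/
def Solves {n : ℕ} (Ω : Set (EuclideanSpace ℝ (Fin n))) (a : EReal) (lam : ℝ)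
    (f : ℝ → ℝ) (u : EuclideanSpace ℝ (Fin n) → ℝ) : Prop :=
  ContDiff ℝ (⊤ : ℕ∞) u ∧ (∀ x ∈ Ω, 0 ≤ u x ∧ (u x : EReal) < a) ∧
  (∀ x ∈ Ω, lap (lap u) x = lam * f (u x)) ∧
  (∀ x ∈ frontier Ω, u x = 0) ∧ (∀ x ∈ frontier Ω, lap u x = 0)

/-- `u` is a semistable solution: the second variation is nonnegative over
test functions in `H² ∩ H¹₀` (modelled by smooth functions vanishing on `∂Ω`). -/
def Semistable {n : ℕ} (Ω : Set (EuclideanSpace ℝ (Fin n))) (lam : ℝ)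
    (f : ℝ → ℝ) (u : EuclideanSpace ℝ (Fin n) → ℝ) : Prop :=
  ∀ φ : EuclideanSpace ℝ (Fin n) → ℝ, ContDiff ℝ (⊤ : ℕ∞) φ → (∀ x ∈ frontier Ω, φ x = 0) →
    0 ≤ ∫ x in Ω, ((lap φ x) ^ 2 - lam * deriv f (u x) * (φ x) ^ 2)

/-- `u` satisfies the stability inequality
`√λ ∫ √(f'(u)) φ² ≤ ∫ |∇φ|²` for all `φ ∈ H¹₀(Ω)`
(modelled by smooth compactly supported test functions). -/
def StabIneq {n : ℕ} (Ω : Set (EuclideanSpace ℝ (Fin n))) (lam : ℝ)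
    (f : ℝ → ℝ) (u : EuclideanSpace ℝ (Fin n) → ℝ) : Prop :=
  ∀ φ : EuclideanSpace ℝ (Fin n) → ℝ, ContDiff ℝ (⊤ : ℕ∞) φ → HasCompactSupport φ →
    tsupport φ ⊆ Ω →
    Real.sqrt lam * ∫ x in Ω, Real.sqrt (deriv f (u x)) * (φ x) ^ 2 ≤
      ∫ x in Ω, ‖gradient φ x‖ ^ 2

/-- The quartic polynomial `P_f(α, τ₋, τ₊)`. -/
def Pf (τm τp α : ℝ) : ℝ :=
  (2 - τm) ^ 2 * α ^ 4 - 8 * (2 - τp) * α ^ 2 + 4 * (4 - 3 * τp) * α - 4 * (1 - τp)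

/-- `F(t) = ∫₀ᵗ f(s) ds`. -/
def Fint (f : ℝ → ℝ) (t : ℝ) : ℝ := ∫ s in (0:ℝ)..t, f s

/-- `f̃(t) = f(t) - f(0)`. -/
def ftil (f : ℝ → ℝ) (t : ℝ) : ℝ := f t - f 0

/-- `Θ(t) = ∫₀ᵗ θ'(s)² ds`. -/
def Theta (θ : ℝ → ℝ) (t : ℝ) : ℝ := ∫ s in (0:ℝ)..t, (deriv θ s) ^ 2

abbrev EE (n : ℕ) := EuclideanSpace ℝ (Fin n)

/-- The superlevel set at which cut-off functions live. -/
def cutK {n : ℕ} (Ω : Set (EE n)) (z : EE n → ℝ) (m0 : ℝ) : Set (EE n) :=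
  {x | x ∈ closure Ω ∧ m0 ≤ z x}

lemma cutK_compact {n : ℕ} {Ω : Set (EE n)} (hb : Bornology.IsBounded Ω) {z : EE n → ℝ}
    (hzc : Continuous z) (m0 : ℝ) : IsCompact (cutK Ω z m0) := by
  have h1 : IsCompact (closure Ω) := hb.isCompact_closure
  exact h1.inter_right (isClosed_le continuous_const hzc)

lemma cutK_sub {n : ℕ} {Ω : Set (EE n)} (ho : IsOpen Ω) {z : EE n → ℝ} {m0 : ℝ}
    (hfr : ∀ x ∈ frontier Ω, z x < m0) : cutK Ω z m0 ⊆ Ω := by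
  rintro x ⟨hx, hm⟩
  by_contra hxo
  have : x ∈ frontier Ω := by
    rw [ho.frontier_eq]; exact ⟨hx, hxo⟩
  exact absurd (hfr x this) (not_lt.2 hm)

lemma cut_integrable {n : ℕ} {Ω : Set (EE n)} (ho : IsOpen Ω) (hb : Bornology.IsBounded Ω)
    {z : EE n → ℝ} (hzc : Continuous z) {m0 : ℝ} (hfr : ∀ x ∈ frontier Ω, z x < m0)
    {F : EE n → ℝ} (hF : ContinuousOn F Ω) (hF0 : ∀ x ∈ Ω, z x < m0 → F x = 0) :
    IntegrableOn F Ω := by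
  have hK := cutK_compact hb hzc m0
  have hs := cutK_sub ho hfr
  have h1 : IntegrableOn F (cutK Ω z m0) := (hF.mono hs).integrableOn_compact hK
  refine h1.of_forall_sdiff_eq_zero ho.measurableSet ?_
  rintro x ⟨hx, hxK⟩
  apply hF0 x hx
  by_contra h
  exact hxK ⟨subset_closure hx, not_lt.1 h⟩

lemma cut_tsupport {n : ℕ} {Ω : Set (EE n)} (hb : Bornology.IsBounded Ω)
    {z : EE n → ℝ} (hzc : Continuous z) {m0 : ℝ}
    {H : ℝ → ℝ} (hH0 : ∀ t ≤ m0, H t = 0) :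
    tsupport (Ω.indicator (fun x => H (z x))) ⊆ cutK Ω z m0 := by
  apply closure_minimal _ (cutK_compact hb hzc m0).isClosed
  intro x hx
  have hxO : x ∈ Ω := by
    by_contra h
    exact hx (Set.indicator_of_notMem h _)
  refine ⟨subset_closure hxO, ?_⟩
  by_contra h
  apply hx
  rw [Set.indicator_of_mem hxO, hH0 _ (not_le.1 h).le]

lemma cut_contDiff {n : ℕ} {Ω : Set (EE n)} (ho : IsOpen Ω) (hb : Bornology.IsBounded Ω)
    {z : EE n → ℝ} (hz : ContDiff ℝ (⊤ : ℕ∞) z) {m0 : ℝ} (hfr : ∀ x ∈ frontier Ω, z x < m0)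
    {H : ℝ → ℝ} (hH : ∀ x ∈ Ω, ContDiffAt ℝ (⊤ : ℕ∞) H (z x)) (hH0 : ∀ t ≤ m0, H t = 0) :
    ContDiff ℝ (⊤ : ℕ∞) (Ω.indicator (fun x => H (z x))) := by
  rw [contDiff_iff_contDiffAt]
  intro x
  by_cases hx : x ∈ Ω
  · have h1 : ContDiffAt ℝ (⊤ : ℕ∞) (fun x => H (z x)) x :=
      (hH x hx).comp x hz.contDiffAt
    refine h1.congr_of_eventuallyEq ?_
    filter_upwards [ho.mem_nhds hx] with y hy
    exact Set.indicator_of_mem hy _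
  · have hxK : x ∉ tsupport (Ω.indicator (fun x => H (z x))) := fun h =>
      hx (cutK_sub ho hfr (cut_tsupport hb hz.continuous hH0 h))
    have := notMem_tsupport_iff_eventuallyEq.1 hxK
    exact contDiffAt_const.congr_of_eventuallyEq this

lemma cut_fderiv {n : ℕ} {Ω : Set (EE n)} (ho : IsOpen Ω) 
    {z : EE n → ℝ} (hz : ContDiff ℝ (⊤ : ℕ∞) z) 
    {H : ℝ → ℝ} (hH : ∀ x ∈ Ω, ContDiffAt ℝ (⊤ : ℕ∞) H (z x)) {x : EE n} (hx : x ∈ Ω) :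
    fderiv ℝ (Ω.indicator (fun x => H (z x))) x = deriv H (z x) • fderiv ℝ z x := by
  have h0 : (Ω.indicator (fun x => H (z x))) =ᶠ[𝓝 x] (fun x => H (z x)) := by
    filter_upwards [ho.mem_nhds hx] with y hy
    exact Set.indicator_of_mem hy _
  rw [h0.fderiv_eq]
  have h1 : HasDerivAt H (deriv H (z x)) (z x) :=
    ((hH x hx).differentiableAt (by simp)).hasDerivAt
  have h2 : HasFDerivAt z (fderiv ℝ z x) x := (hz.differentiable (by simp) x).hasFDerivAt
  exact (h1.comp_hasFDerivAt x h2).fderiv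

/-- Sum of squares of partial derivatives. -/
def gsq {n : ℕ} (z : EE n → ℝ) (x : EE n) : ℝ :=
  ∑ i : Fin n, (fderiv ℝ z x (EuclideanSpace.single i (1:ℝ))) ^ 2

lemma gsq_nonneg {n : ℕ} (z : EE n → ℝ) (x : EE n) : 0 ≤ gsq z x :=
  Finset.sum_nonneg fun _ _ => sq_nonneg _

lemma norm_gradient_sq {n : ℕ} (z : EE n → ℝ) (x : EE n) : ‖gradient z x‖ ^ 2 = gsq z x := by
  rw [EuclideanSpace.norm_sq_eq]
  unfold gsq
  refine Finset.sum_congr rfl fun i _ => ?_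
  rw [← inner_gradient_left, EuclideanSpace.inner_single_right]
  simp

lemma lap_eq {n : ℕ} {z : EE n → ℝ} (hz : ContDiff ℝ (⊤ : ℕ∞) z) (x : EE n) :
    lap z x = ∑ i : Fin n, fderiv ℝ (fun y => fderiv ℝ z y (EuclideanSpace.single i (1:ℝ))) x
      (EuclideanSpace.single i (1:ℝ)) := by
  unfold lap
  refine Finset.sum_congr rfl fun i _ => ?_
  rw [iteratedFDeriv_two_apply]
  have hd : DifferentiableAt ℝ (fderiv ℝ z) x :=
    (hz.fderiv_right (m := 1) (by norm_cast)).differentiable (by simp) x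
  rw [fderiv_clm_apply hd (differentiableAt_const _)]
  simp

lemma contDiff_pd {n : ℕ} {z : EE n → ℝ} (hz : ContDiff ℝ (⊤ : ℕ∞) z) (e : EE n) :
    ContDiff ℝ (⊤ : ℕ∞) (fun y => fderiv ℝ z y e) :=
  (hz.fderiv_right (m := (⊤ : ℕ∞)) (by norm_cast)).clm_apply contDiff_const

lemma contDiff_lap {n : ℕ} {z : EE n → ℝ} (hz : ContDiff ℝ (⊤ : ℕ∞) z) :
    ContDiff ℝ (⊤ : ℕ∞) (lap z) := by
  have : lap z = fun x => ∑ i : Fin n, fderiv ℝ (fun y => fderiv ℝ z y (EuclideanSpace.single i (1:ℝ))) x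
      (EuclideanSpace.single i (1:ℝ)) := funext (lap_eq hz)
  rw [this]
  exact ContDiff.sum fun i _ => contDiff_pd (contDiff_pd hz _) _

/-- one partial integration by parts -/
lemma ibp_one {n : ℕ} {φ g : EE n → ℝ} (hφ : ContDiff ℝ (⊤ : ℕ∞) φ) (hc : HasCompactSupport φ)
    (hg : ContDiff ℝ (⊤ : ℕ∞) g) (e : EE n) :
    ∫ x, φ x * fderiv ℝ g x e = - ∫ x, fderiv ℝ φ x e * g x := by
  apply integral_mul_fderiv_eq_neg_fderiv_mul_of_integrable
  · apply Continuous.integrable_of_hasCompactSupport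
    · exact (contDiff_pd hφ e).continuous.mul hg.continuous
    · exact (hc.fderiv_apply (𝕜 := ℝ) e).mul_right
  · apply Continuous.integrable_of_hasCompactSupport
    · exact hφ.continuous.mul (contDiff_pd hg e).continuous
    · exact hc.mul_right
  · apply Continuous.integrable_of_hasCompactSupport
    · exact hφ.continuous.mul hg.continuous
    · exact hc.mul_right
  · intro x _; exact hφ.differentiable (by simp) x
  · intro x _; exact hg.differentiable (by simp) x

lemma ibp_cut {n : ℕ} {Ω : Set (EE n)} (ho : IsOpen Ω) (hb : Bornology.IsBounded Ω)
    {z : EE n → ℝ} (hz : ContDiff ℝ (⊤ : ℕ∞) z) {m0 : ℝ} (hfr : ∀ x ∈ frontier Ω, z x < m0)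
    {H : ℝ → ℝ} (hH : ∀ x ∈ Ω, ContDiffAt ℝ (⊤ : ℕ∞) H (z x)) (hH0 : ∀ t ≤ m0, H t = 0) :
    ∫ x in Ω, H (z x) * (- lap z x) = ∫ x in Ω, deriv H (z x) * gsq z x := by
  set φ := Ω.indicator (fun x => H (z x)) with hφd
  have hφ : ContDiff ℝ (⊤ : ℕ∞) φ := cut_contDiff ho hb hz hfr hH hH0
  have hts := cut_tsupport (Ω := Ω) hb hz.continuous hH0
  have hc : HasCompactSupport φ :=
    (cutK_compact hb hz.continuous m0).of_isClosed_subset (isClosed_tsupport _) hts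
  have htO : tsupport φ ⊆ Ω := hts.trans (cutK_sub ho hfr)
  have hz0 : ∀ x ∉ Ω, φ x = 0 := fun x hx => Set.indicator_of_notMem hx _
  have hdz0 : ∀ x ∉ Ω, fderiv ℝ φ x = 0 := fun x hx => by
    have : x ∉ tsupport (fderiv ℝ φ) := fun h => hx (htO (tsupport_fderiv_subset ℝ h))
    exact image_eq_zero_of_notMem_tsupport this
  have e1 : ∫ x in Ω, H (z x) * (- lap z x) = ∫ x, φ x * (- lap z x) := by
    refine Eq.trans ?_ (setIntegral_eq_integral_of_forall_compl_eq_zero (s := Ω) ?_)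
    · refine setIntegral_congr_fun ho.measurableSet fun x hx => ?_
      simp only [hφd, Set.indicator_of_mem hx]
    · intro x hx; rw [hz0 x hx, zero_mul]
  have e2 : ∫ x in Ω, deriv H (z x) * gsq z x = ∫ x, ∑ i : Fin n,
      fderiv ℝ φ x (EuclideanSpace.single i (1:ℝ)) * fderiv ℝ z x (EuclideanSpace.single i (1:ℝ)) := by
    refine Eq.trans ?_ (setIntegral_eq_integral_of_forall_compl_eq_zero (s := Ω) ?_)
    · refine setIntegral_congr_fun ho.measurableSet fun x hx => ?_
      simp only [hφd, cut_fderiv ho hz hH hx, gsq, Finset.mul_sum]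
      refine Finset.sum_congr rfl fun i _ => ?_
      simp; ring
    · intro x hx; simp [hdz0 x hx]
  rw [e1, e2, integral_finsetSum]
  · have : ∀ x, φ x * (- lap z x) = ∑ i : Fin n, - (φ x * fderiv ℝ (fun y => fderiv ℝ z y (EuclideanSpace.single i (1:ℝ))) x
      (EuclideanSpace.single i (1:ℝ))) := by
      intro x; rw [lap_eq hz, Finset.sum_neg_distrib, mul_neg, Finset.mul_sum]
    simp_rw [this]
    rw [integral_finsetSum]
    · refine Finset.sum_congr rfl fun i _ => ?_
      rw [integral_neg, ibp_one hφ hc (contDiff_pd hz _), neg_neg]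
    · intro i _
      apply Integrable.neg
      apply Continuous.integrable_of_hasCompactSupport
      · exact hφ.continuous.mul (contDiff_pd (contDiff_pd hz _) _).continuous
      · exact hc.mul_right
  · intro i _
    apply Continuous.integrable_of_hasCompactSupport
    · exact (contDiff_pd hφ _).continuous.mul (contDiff_pd hz _).continuous
    · exact (hc.fderiv_apply (𝕜 := ℝ) _).mul_right

lemma grad_cut {n : ℕ} {Ω : Set (EE n)} (ho : IsOpen Ω) (hb : Bornology.IsBounded Ω)
    {z : EE n → ℝ} (hz : ContDiff ℝ (⊤ : ℕ∞) z) {m0 : ℝ} (hfr : ∀ x ∈ frontier Ω, z x < m0)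
    {h H : ℝ → ℝ} (hh : ∀ x ∈ Ω, ContDiffAt ℝ (⊤ : ℕ∞) h (z x))
    (hH : ∀ x ∈ Ω, ContDiffAt ℝ (⊤ : ℕ∞) H (z x)) (hH0 : ∀ t ≤ m0, H t = 0)
    (hd : ∀ x ∈ Ω, deriv H (z x) = (deriv h (z x)) ^ 2) :
    ∫ x in Ω, ‖gradient (Ω.indicator (fun x => h (z x))) x‖ ^ 2 =
      ∫ x in Ω, H (z x) * (- lap z x) := by
  rw [ibp_cut ho hb hz hfr hH hH0]
  refine setIntegral_congr_fun ho.measurableSet fun x hx => ?_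
  simp only [norm_gradient_sq]
  simp only [gsq, cut_fderiv ho hz hh hx, hd x hx, Finset.mul_sum]
  refine Finset.sum_congr rfl fun i _ => ?_
  simp; ring

lemma stab_cut {n : ℕ} {Ω : Set (EE n)} (ho : IsOpen Ω) (hb : Bornology.IsBounded Ω)
    {lam : ℝ} {f : ℝ → ℝ} {u : EE n → ℝ} (hs : StabIneq Ω lam f u)
    {z : EE n → ℝ} (hz : ContDiff ℝ (⊤ : ℕ∞) z) {m0 : ℝ} (hfr : ∀ x ∈ frontier Ω, z x < m0)
    {h H : ℝ → ℝ} (hh : ∀ x ∈ Ω, ContDiffAt ℝ (⊤ : ℕ∞) h (z x)) (hh0 : ∀ t ≤ m0, h t = 0)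
    (hH : ∀ x ∈ Ω, ContDiffAt ℝ (⊤ : ℕ∞) H (z x)) (hH0 : ∀ t ≤ m0, H t = 0)
    (hd : ∀ x ∈ Ω, deriv H (z x) = (deriv h (z x)) ^ 2) :
    Real.sqrt lam * ∫ x in Ω, Real.sqrt (deriv f (u x)) * (h (z x)) ^ 2 ≤
      ∫ x in Ω, H (z x) * (- lap z x) := by
  have hts := cut_tsupport (Ω := Ω) hb hz.continuous hh0
  have := hs _ (cut_contDiff ho hb hz hfr hh hh0)
    ((cutK_compact hb hz.continuous m0).of_isClosed_subset (isClosed_tsupport _) hts)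
    (hts.trans (cutK_sub ho hfr))
  rw [grad_cut ho hb hz hfr hh hH hH0 hd] at this
  refine le_trans (le_of_eq ?_) this
  congr 1
  refine setIntegral_congr_fun ho.measurableSet fun x hx => ?_
  simp only [Set.indicator_of_mem hx]

lemma poincare {n : ℕ} (i : Fin n) {R : ℝ} {φ : EE n → ℝ} (hφ : ContDiff ℝ (⊤ : ℕ∞) φ)
    (hc : HasCompactSupport φ) (hR : ∀ x, φ x ≠ 0 → ‖x‖ ≤ R) :
    ∫ x, (φ x) ^ 2 ≤ 4 * R ^ 2 * ∫ x, gsq φ x := by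
  set e : EE n := EuclideanSpace.single i (1:ℝ) with he
  have hg : ContDiff ℝ (⊤ : ℕ∞) (fun x : EE n => x i) := by fun_prop
  have hge : ∀ x, fderiv ℝ (fun x : EE n => x i) x e = 1 := by
    intro x
    have : HasFDerivAt (fun x : EE n => x i) (EuclideanSpace.proj i : EE n →L[ℝ] ℝ) x :=
      (EuclideanSpace.proj i : EE n →L[ℝ] ℝ).hasFDerivAt
    rw [this.fderiv]; simp [he]
  have hφ2 : ContDiff ℝ (⊤ : ℕ∞) (fun x => φ x ^ 2) := hφ.pow 2
  have hc2 : HasCompactSupport (fun x => φ x ^ 2) := by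
    have h2 : (fun x => φ x ^ 2) = φ * φ := by funext x; simp [pow_two]
    rw [h2]; exact hc.mul_left (f := φ)
  have h1 := ibp_one hφ2 hc2 hg e
  simp only [hge, mul_one] at h1
  have hd : ∀ x, fderiv ℝ (fun x => φ x ^ 2) x e = 2 * φ x * fderiv ℝ φ x e := by
    intro x
    have := ((hφ.differentiable (by simp) x).hasFDerivAt.pow 2).fderiv
    rw [this]; simp
  have hi2 : Integrable (fun x => φ x ^ 2) := hφ2.continuous.integrable_of_hasCompactSupport hc2
  have hig : Integrable (fun x => gsq φ x) := by
    apply Continuous.integrable_of_hasCompactSupport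
    · unfold gsq
      exact continuous_finsetSum _ fun j _ => (contDiff_pd hφ _).continuous.pow 2
    · have := (hc.fderiv (𝕜 := ℝ))
      refine this.mono' ?_
      intro x hx
      apply subset_tsupport
      intro h0
      apply hx
      simp [gsq, h0]
  have hle : ∫ x, (φ x) ^ 2 ≤ ∫ x, (1/2 * φ x ^ 2 + 2 * R ^ 2 * gsq φ x) := by
    rw [h1, ← integral_neg]
    apply integral_mono
    · apply Integrable.neg
      apply Continuous.integrable_of_hasCompactSupport
      · exact (contDiff_pd hφ2 e).continuous.mul hg.continuous
      · exact (hc2.fderiv_apply (𝕜 := ℝ) e).mul_right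
    · exact (hi2.const_mul _).add (hig.const_mul _)
    · intro x
      simp only [hd]
      have hx1 : (fderiv ℝ φ x e) ^ 2 ≤ gsq φ x := by
        unfold gsq
        exact Finset.single_le_sum (f := fun j => (fderiv ℝ φ x (EuclideanSpace.single j (1:ℝ))) ^ 2) (fun j _ => sq_nonneg _) (Finset.mem_univ i)
      by_cases h0 : φ x = 0
      · rw [h0]; simp; have := gsq_nonneg φ x; positivity
      · have hxi : |x i| ≤ R := (PiLp.norm_apply_le x i).trans (hR x h0)
        have hx2 : (x i) ^ 2 ≤ R ^ 2 := by
          rw [← sq_abs]; exact pow_le_pow_left₀ (abs_nonneg _) hxi 2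
        have hx3 : (x i) ^ 2 * (fderiv ℝ φ x e) ^ 2 ≤ R ^ 2 * gsq φ x :=
          mul_le_mul hx2 hx1 (sq_nonneg _) (sq_nonneg _)
        nlinarith [sq_nonneg (φ x + 2 * x i * fderiv ℝ φ x e)]
  rw [integral_add (hi2.const_mul _) (hig.const_mul _), integral_const_mul, integral_const_mul] at hle
  linarith

lemma poincare_cut {n : ℕ} (i : Fin n) {Ω : Set (EE n)} (ho : IsOpen Ω) (hb : Bornology.IsBounded Ω)
    {R : ℝ} (hR : ∀ x ∈ Ω, ‖x‖ ≤ R)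
    {z : EE n → ℝ} (hz : ContDiff ℝ (⊤ : ℕ∞) z) {m0 : ℝ} (hfr : ∀ x ∈ frontier Ω, z x < m0)
    {h H : ℝ → ℝ} (hh : ∀ x ∈ Ω, ContDiffAt ℝ (⊤ : ℕ∞) h (z x)) (hh0 : ∀ t ≤ m0, h t = 0)
    (hH : ∀ x ∈ Ω, ContDiffAt ℝ (⊤ : ℕ∞) H (z x)) (hH0 : ∀ t ≤ m0, H t = 0)
    (hd : ∀ x ∈ Ω, deriv H (z x) = (deriv h (z x)) ^ 2) :
    ∫ x in Ω, (h (z x)) ^ 2 ≤ 4 * R ^ 2 * ∫ x in Ω, H (z x) * (- lap z x) := by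
  have hts := cut_tsupport (Ω := Ω) hb hz.continuous hh0
  have hφ := cut_contDiff ho hb hz hfr hh hh0
  have hc : HasCompactSupport (Ω.indicator (fun x => h (z x))) :=
    ((cutK_compact hb hz.continuous m0).of_isClosed_subset (isClosed_tsupport _) hts)
  have htO := (hts.trans (cutK_sub ho hfr))
  rw [← grad_cut ho hb hz hfr hh hH hH0 hd]
  have := poincare i hφ hc (R := R) (fun x hx => by
    apply hR
    by_contra hxo
    exact hx (Set.indicator_of_notMem hxo _))
  have e1 : ∫ x in Ω, (h (z x)) ^ 2 = ∫ x, (Ω.indicator (fun x => h (z x)) x) ^ 2 := by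
    refine Eq.trans ?_ (setIntegral_eq_integral_of_forall_compl_eq_zero (s := Ω) ?_)
    · refine setIntegral_congr_fun ho.measurableSet fun x hx => ?_
      simp only [Set.indicator_of_mem hx]
    · intro x hx; simp [Set.indicator_of_notMem hx]
  have e2 : ∫ x in Ω, ‖gradient (Ω.indicator (fun x => h (z x))) x‖ ^ 2 =
      ∫ x, gsq (Ω.indicator (fun x => h (z x))) x := by
    simp only [norm_gradient_sq]
    refine setIntegral_eq_integral_of_forall_compl_eq_zero ?_
    intro x hx
    have h1 : x ∉ tsupport (fderiv ℝ (Ω.indicator (fun x => h (z x)))) :=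
      fun h => hx (htO (tsupport_fderiv_subset ℝ h))
    simp [gsq, image_eq_zero_of_notMem_tsupport h1]
  rw [e1, e2]
  exact this

lemma lap_neg {n : ℕ} {z : EE n → ℝ} (hz : ContDiff ℝ (⊤ : ℕ∞) z) (c : ℝ) (x : EE n) :
    lap (fun y => c * z y) x = c * lap z x := by
  have hz' : ContDiff ℝ (⊤ : ℕ∞) (fun y => c * z y) := contDiff_const.mul hz
  rw [lap_eq hz', lap_eq hz, Finset.mul_sum]
  refine Finset.sum_congr rfl fun i _ => ?_
  have : ∀ y, fderiv ℝ (fun y => c * z y) y (EuclideanSpace.single i (1:ℝ)) =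
      c * fderiv ℝ z y (EuclideanSpace.single i (1:ℝ)) := by
    intro y
    rw [fderiv_const_mul (hz.differentiable (by simp) y)]; simp
  simp only [this]
  rw [fderiv_const_mul ((contDiff_pd hz _).differentiable (by simp) x)]; simp

lemma lap_add {n : ℕ} {z y : EE n → ℝ} (hz : ContDiff ℝ (⊤ : ℕ∞) z) (hy : ContDiff ℝ (⊤ : ℕ∞) y) (x : EE n) :
    lap (fun w => z w + y w) x = lap z x + lap y x := by
  have hz' : ContDiff ℝ (⊤ : ℕ∞) (fun w => z w + y w) := hz.add hy
  rw [lap_eq hz', lap_eq hz, lap_eq hy, ← Finset.sum_add_distrib]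
  refine Finset.sum_congr rfl fun i _ => ?_
  have : ∀ w, fderiv ℝ (fun w => z w + y w) w (EuclideanSpace.single i (1:ℝ)) =
      fderiv ℝ z w (EuclideanSpace.single i (1:ℝ)) + fderiv ℝ y w (EuclideanSpace.single i (1:ℝ)) := by
    intro w
    rw [fderiv_fun_add (hz.differentiable (by simp) w) (hy.differentiable (by simp) w)]; simp
  simp only [this]
  rw [fderiv_fun_add ((contDiff_pd hz _).differentiable (by simp) x) ((contDiff_pd hy _).differentiable (by simp) x)]; simp

lemma contDiff_quad {n : ℕ} (x0 : EE n) (c r : ℝ) :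
    ContDiff ℝ (⊤ : ℕ∞) (fun y : EE n => c * (‖y - x0‖ ^ 2 - r)) :=
  contDiff_const.mul (((contDiff_id.sub contDiff_const).norm_sq ℝ).sub contDiff_const)

lemma lap_quad {n : ℕ} (x0 : EE n) (c r : ℝ) (x : EE n) :
    lap (fun y : EE n => c * (‖y - x0‖ ^ 2 - r)) x = c * (2 * n) := by
  have hq : ContDiff ℝ (⊤ : ℕ∞) (fun y : EE n => ‖y - x0‖ ^ 2 - r) :=
    (((contDiff_id.sub contDiff_const).norm_sq ℝ).sub contDiff_const)
  rw [lap_neg hq, lap_eq hq]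
  congr 1
  have h1 : ∀ (i : Fin n) (y : EE n), fderiv ℝ (fun y : EE n => ‖y - x0‖ ^ 2 - r) y (EuclideanSpace.single i (1:ℝ))
      = 2 * (y i - x0 i) := by
    intro i y
    have : HasFDerivAt (fun y : EE n => ‖y - x0‖ ^ 2 - r) (2 • (innerSL ℝ (y - x0))) y := by
      have := ((hasFDerivAt_id (𝕜 := ℝ) y).sub_const x0).norm_sq.sub_const r
      simpa using this
    rw [this.fderiv]
    simp [EuclideanSpace.inner_single_right]
  have h2 : ∀ (i : Fin n), fderiv ℝ (fun y : EE n => 2 * (y i - x0 i)) x (EuclideanSpace.single i (1:ℝ)) = 2 := by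
    intro i
    have : HasFDerivAt (fun x : EE n => 2 * (x i - x0 i)) ((2:ℝ) • (EuclideanSpace.proj i : EE n →L[ℝ] ℝ)) x :=
      ((EuclideanSpace.proj i : EE n →L[ℝ] ℝ).hasFDerivAt.sub_const _).const_mul 2
    rw [this.fderiv]; simp
  simp only [h1, h2]
  simp; ring

lemma max_principle {n : ℕ} {U : Set (EE n)} (ho : IsOpen U) (hb : Bornology.IsBounded U)
    {z : EE n → ℝ} (hz : ContDiff ℝ (⊤ : ℕ∞) z) (hl : ∀ x ∈ U, lap z x < 0)
    (hfr : ∀ x ∈ frontier U, 0 ≤ z x) : ∀ x ∈ U, 0 ≤ z x := by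
  intro x0 hx0
  by_contra hneg
  push Not at hneg
  set m0 : ℝ := - z x0 / 2 with hm0
  have hm0p : 0 < m0 := by linarith
  set y : EE n → ℝ := fun x => (-1) * z x with hy
  have hyc : ContDiff ℝ (⊤ : ℕ∞) y := contDiff_const.mul hz
  have hyl : ∀ x, lap y x = - lap z x := fun x => by rw [hy, lap_neg hz]; ring
  set H : ℝ → ℝ := fun t => expNegInvGlue (t - m0) with hH
  have hHc : ContDiff ℝ (⊤ : ℕ∞) H := expNegInvGlue.contDiff.comp (contDiff_id.sub contDiff_const)
  have hHm : Monotone H := fun s t hst => expNegInvGlue.monotone (by linarith)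
  have hH0 : ∀ t ≤ m0, H t = 0 := fun t ht => expNegInvGlue.zero_of_nonpos (by linarith)
  have hyfr : ∀ x ∈ frontier U, y x < m0 := fun x hx => by
    have := hfr x hx; simp only [hy]; linarith
  have h1 := ibp_cut ho hb hyc hyfr (H := H) (fun x _ => hHc.contDiffAt) hH0
  have h2 : 0 ≤ ∫ x in U, deriv H (y x) * gsq y x :=
    integral_nonneg fun x => mul_nonneg hHm.deriv_nonneg (gsq_nonneg _ _)
  rw [← h1] at h2
  simp only [hyl, neg_neg] at h2
  have hcont : Continuous (fun x => H (y x) * lap z x) :=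
    (hHc.continuous.comp hyc.continuous).mul (contDiff_lap hz).continuous
  have hint : IntegrableOn (fun x => -(H (y x) * lap z x)) U :=
    cut_integrable ho hb hyc.continuous hyfr hcont.neg.continuousOn (fun x _ hx => by
      rw [hH0 _ hx.le]; simp)
  have hnn : ∀ x ∈ U, 0 ≤ -(H (y x) * lap z x) := fun x hx => by
    have a1 : 0 ≤ H (y x) := expNegInvGlue.nonneg _
    have := hl x hx
    nlinarith
  have hpos : 0 < ∫ x in U, -(H (y x) * lap z x) := by
    rw [setIntegral_pos_iff_support_of_nonneg_ae]
    · have hopen : IsOpen (Function.support (fun x => -(H (y x) * lap z x)) ∩ U) :=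
        (hcont.neg.isOpen_support).inter ho
      refine hopen.measure_pos _ ⟨x0, ?_, hx0⟩
      have a1 : 0 < H (y x0) := expNegInvGlue.pos_of_pos (by simp only [hy]; linarith)
      have := hl x0 hx0
      simp only [Function.mem_support]
      nlinarith
    · filter_upwards [ae_restrict_mem ho.measurableSet] with x hx using hnn x hx
    · exact hint
  rw [integral_neg] at hpos
  linarith

/-- open interval `(0,a_f)` -/
def dom0 (a : EReal) : Set ℝ := {t : ℝ | 0 < t ∧ (t : EReal) < a}

lemma isOpen_lta (a : EReal) : IsOpen {t : ℝ | (t : EReal) < a} :=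
  isOpen_lt continuous_coe_real_ereal continuous_const

lemma isOpen_dom0 (a : EReal) : IsOpen (dom0 a) :=
  (isOpen_lt continuous_const continuous_id).inter (isOpen_lta a)

lemma dom0_sub (a : EReal) : dom0 a ⊆ domf a := fun _ ht => ⟨ht.1.le, ht.2⟩

lemma lta_of_le {a : EReal} {s t : ℝ} (hst : s ≤ t) (ht : (t : EReal) < a) : (s : EReal) < a :=
  lt_of_le_of_lt (by exact_mod_cast hst) ht

lemma af_eventually {a : EReal} (ha : 0 < a) {P : ℝ → Prop} (h : ∀ᶠ t in afFilter a, P t) :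
    ∃ M : ℝ, M ∈ dom0 a ∧ ∀ t, M ≤ t → (t : EReal) < a → P t := by
  unfold afFilter at h
  by_cases htop : a = ⊤
  · rw [if_pos htop] at h
    obtain ⟨M, hM⟩ := eventually_atTop.1 h
    refine ⟨max M 1, ⟨by positivity, ?_⟩, fun t ht _ => hM t (le_trans (le_max_left _ _) ht)⟩
    rw [htop]; exact EReal.coe_lt_top _
  · rw [if_neg htop] at h
    have hbot : a ≠ ⊥ := fun hb => by rw [hb] at ha; exact absurd ha (by simp)
    lift a to ℝ using ⟨htop, hbot⟩
    simp only [EReal.toReal_coe] at h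
    have ha' : 0 < a := by exact_mod_cast ha
    obtain ⟨l, hl, hl2⟩ := (mem_nhdsLT_iff_exists_Ioo_subset' ha').1 h
    have hla : l < a := hl
    refine ⟨(max l 0 + a) / 2, ⟨?_, ?_⟩, ?_⟩
    · have := le_max_right l 0; linarith
    · have : max l 0 < a := max_lt hla ha'
      have : (max l 0 + a) / 2 < a := by linarith
      exact_mod_cast this
    · intro t ht hta
      have hta' : t < a := by exact_mod_cast hta
      have : max l 0 < a := max_lt hla ha'
      have := le_max_left l 0
      exact hl2 ⟨by linarith, hta'⟩

lemma f_contDiffAt {a : EReal} {f : ℝ → ℝ} (hf : HypH a f) {t : ℝ} (ht : t ∈ dom0 a) :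
    ContDiffAt ℝ (⊤ : ℕ∞) f t :=
  hf.smooth.contDiffAt (Filter.mem_of_superset ((isOpen_dom0 a).mem_nhds ht) (dom0_sub a))

lemma contDiffAt_deriv {g : ℝ → ℝ} {t : ℝ} (h : ContDiffAt ℝ (⊤ : ℕ∞) g t) :
    ContDiffAt ℝ (⊤ : ℕ∞) (deriv g) t :=
  have h1 : ContDiffAt ℝ (⊤ : ℕ∞) (fun s => fderiv ℝ g s 1) t :=
    (h.fderiv_right (m := (⊤ : ℕ∞)) (by norm_cast)).clm_apply contDiffAt_const
  h1.congr_of_eventuallyEq (Filter.Eventually.of_forall fun s => by simp)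

lemma f_hasDerivAt {a : EReal} {f : ℝ → ℝ} (hf : HypH a f) {t : ℝ} (ht : t ∈ dom0 a) :
    HasDerivAt f (deriv f t) t := ((f_contDiffAt hf ht).differentiableAt (by simp)).hasDerivAt

lemma zero_mem_domf {a : EReal} (ha : 0 < a) : (0:ℝ) ∈ domf a := ⟨le_rfl, by exact_mod_cast ha⟩

lemma ftil_le {a : EReal} {f : ℝ → ℝ} (hf : HypH a f) {t : ℝ} (ht : t ∈ dom0 a) :
    ftil f t ≤ t * deriv f t := by
  have h := hf.convex.slope_le_deriv (zero_mem_domf hf.a_pos) (dom0_sub a ht) ht.1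
    (f_hasDerivAt hf ht).differentiableAt
  rw [slope_def_field, sub_zero, div_le_iff₀ ht.1] at h
  unfold ftil; linarith

lemma ftil_pos {a : EReal} {f : ℝ → ℝ} (hf : HypH a f) {t : ℝ} (ht : t ∈ dom0 a) :
    0 < ftil f t := sub_pos.2 (hf.mono (zero_mem_domf hf.a_pos) (dom0_sub a ht) ht.1)

lemma fd_pos {a : EReal} {f : ℝ → ℝ} (hf : HypH a f) {t : ℝ} (ht : t ∈ dom0 a) :
    0 < deriv f t := by
  have h1 := ftil_le hf ht
  have h2 := ftil_pos hf ht
  exact pos_of_mul_pos_right (h2.trans_le h1) ht.1.le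

lemma fd_mono {a : EReal} {f : ℝ → ℝ} (hf : HypH a f) : MonotoneOn (deriv f) (dom0 a) := by
  have hc : Convex ℝ (dom0 a) := by
    apply Set.OrdConnected.convex
    constructor
    rintro x hx y hy z ⟨h1, h2⟩
    exact ⟨hx.1.trans_le h1, lta_of_le h2 hy.2⟩
  exact (hf.convex.subset (dom0_sub a) hc).monotoneOn_deriv
    fun x hx => (f_hasDerivAt hf hx).differentiableAt

lemma f_mono {a : EReal} {f : ℝ → ℝ} (hf : HypH a f) {s t : ℝ} (hs : 0 ≤ s) (hst : s ≤ t)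
    (hta : (t : EReal) < a) : f s ≤ f t :=
  hf.mono.monotoneOn ⟨hs, lta_of_le hst hta⟩ ⟨hs.trans hst, hta⟩ hst

lemma n_pos {n : ℕ} {Ω : Set (EE n)} (hΩ : GoodDomain Ω) {a : EReal} {f : ℝ → ℝ} (hf : HypH a f)
    {lam : ℝ} (hl : 0 < lam) {u : EE n → ℝ} (hs : Solves Ω a lam f u) : 0 < n := by
  obtain ⟨x, hx⟩ := hΩ.2.2
  rcases Nat.eq_zero_or_pos n with rfl | h
  · exfalso
    have h1 := hs.2.2.1 x hx
    have h2 := hf.pos (u x) (hs.2.1 x hx)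
    have h3 : lap (lap u) x = 0 := by unfold lap; simp
    rw [h3] at h1
    have := mul_pos hl h2
    linarith
  · exact h

lemma tau_plus_ev {a : EReal} {f : ℝ → ℝ} (h0 : 0 < tauPlus a f) {s : ℝ} (hs : tauPlus a f < s) :
    ∀ᶠ t in afFilter a, f t * deriv (deriv f) t / (deriv f t) ^ 2 < s := by
  refine eventually_lt_of_limsup_lt hs ?_
  by_contra hb
  have : {c : ℝ | ∀ᶠ t in afFilter a, f t * deriv (deriv f) t / (deriv f t) ^ 2 ≤ c} = ∅ := by
    apply Set.eq_empty_of_forall_notMem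
    intro c hc
    exact hb ⟨c, hc⟩
  unfold tauPlus at h0
  rw [limsup_eq, this, Real.sInf_empty] at h0
  exact lt_irrefl _ h0

lemma tau_minus_ev {a : EReal} {f : ℝ → ℝ} (h0 : 0 < tauMinus a f) {s : ℝ} (hs : s < tauMinus a f) :
    ∀ᶠ t in afFilter a, s < f t * deriv (deriv f) t / (deriv f t) ^ 2 := by
  refine eventually_lt_of_lt_liminf hs ?_
  by_contra hb
  have : {c : ℝ | ∀ᶠ t in afFilter a, c ≤ f t * deriv (deriv f) t / (deriv f t) ^ 2} = ∅ := by
    apply Set.eq_empty_of_forall_notMem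
    intro c hc
    exact hb ⟨c, hc⟩
  unfold tauMinus at h0
  rw [liminf_eq, this, Real.sSup_empty] at h0
  exact lt_irrefl _ h0

/-- comparison with a paraboloid on a ball -/
lemma ball_comparison {n : ℕ} {x0 : EE n} {R : ℝ} (hR : 0 < R) {z : EE n → ℝ}
    (hz : ContDiff ℝ (⊤ : ℕ∞) z) {d : ℝ} (hd : 0 < d)
    (hl : ∀ x ∈ Metric.ball x0 R, lap z x ≤ - d) (hnn : ∀ x ∈ Metric.closedBall x0 R, 0 ≤ z x) :
    ∀ x ∈ Metric.ball x0 (R / 2), d * (3 * R ^ 2 / (16 * (n + 1))) ≤ z x := by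
  set c : ℝ := d / (4 * (n + 1)) with hc
  have hn : (0:ℝ) ≤ n := Nat.cast_nonneg n
  have hcp : 0 < c := by positivity
  have hcd : c * (2 * n) < d := by
    rw [hc, div_mul_eq_mul_div, div_lt_iff₀ (by positivity)]; nlinarith
  have hyc : ContDiff ℝ (⊤ : ℕ∞) (fun y => z y + c * (‖y - x0‖ ^ 2 - R ^ 2)) := hz.add (contDiff_quad x0 c _)
  have h1 := max_principle (U := Metric.ball x0 R) Metric.isOpen_ball Metric.isBounded_ball hyc
    (fun x hx => by
      rw [lap_add hz (contDiff_quad x0 c _), lap_quad]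
      have := hl x hx; linarith)
    (fun x hx => by
      have hx1 : x ∈ Metric.sphere x0 R := Metric.frontier_ball_subset_sphere hx
      have hx2 : ‖x - x0‖ = R := by rw [← dist_eq_norm]; exact hx1
      have := hnn x (Metric.sphere_subset_closedBall hx1)
      rw [hx2]; linarith)
  intro x hx
  have hx2 : ‖x - x0‖ < R / 2 := by rw [← dist_eq_norm]; exact hx
  have h2 := h1 x (Metric.ball_subset_ball (by linarith) hx)
  have h3 : ‖x - x0‖ ^ 2 ≤ (R / 2) ^ 2 := pow_le_pow_left₀ (norm_nonneg _) hx2.le 2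
  have h4 : d * (3 * R ^ 2 / (16 * (n + 1))) = c * (3 * R ^ 2 / 4) := by
    rw [hc]; field_simp; ring
  rw [h4]
  nlinarith

lemma lam_bound {n : ℕ} {Ω : Set (EE n)} (hΩ : GoodDomain Ω) {a : EReal} {f : ℝ → ℝ}
    (hf : HypH a f) : ∃ Λ : ℝ, ∀ (lam : ℝ) (u : EE n → ℝ), 0 < lam → Solves Ω a lam f u →
      (∀ x ∈ Ω, 0 < u x) → StabIneq Ω lam f u → √lam ≤ Λ := by
  obtain ⟨ho, hb, x0, hx0⟩ := hΩ
  obtain ⟨R, hR, hRs⟩ := Metric.nhds_basis_closedBall.mem_iff.1 (ho.mem_nhds hx0)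
  have hR' : 0 < R := hR
  have hn : (0:ℝ) ≤ n := Nat.cast_nonneg n
  set k1 : ℝ := 3 * R ^ 2 / (16 * (n + 1)) with hk1
  set k2 : ℝ := 3 * (R/2) ^ 2 / (16 * (n + 1)) with hk2
  have hk1p : 0 < k1 := by positivity
  have hk2p : 0 < k2 := by positivity
  have hf0 := hf.f0_pos
  set d : ℝ := f 0 * k1 * k2 with hd
  have hdp : 0 < d := by positivity
  let φ : ContDiffBump x0 := ⟨R / 16, R / 8, by positivity, by linarith⟩
  set D : ℝ := ∫ x in Ω, ‖gradient (φ : EE n → ℝ) x‖ ^ 2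
  set E : ℝ := ∫ x in Ω, (φ x) ^ 2 with hE
  have hφO : tsupport (φ : EE n → ℝ) ⊆ Metric.ball x0 (R/4) := by
    rw [φ.tsupport_eq]
    exact Metric.closedBall_subset_ball (by change R / 8 < R / 4; linarith)
  have hbO : Metric.ball x0 (R/4) ⊆ Ω :=
    (Metric.ball_subset_closedBall.trans (Metric.closedBall_subset_closedBall (by linarith))).trans hRs
  have hφ : ContDiff ℝ (⊤ : ℕ∞) (φ : EE n → ℝ) := φ.contDiff
  have hphisq : Integrable (fun x => (φ x) ^ 2) := by
    apply (hφ.continuous.pow 2).integrable_of_hasCompactSupport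
    rw [pow_two]; exact φ.hasCompactSupport.mul_left
  have hEp : 0 < E := by
    rw [hE, setIntegral_pos_iff_support_of_nonneg_ae]
    · have hopen : IsOpen (Function.support (fun x => (φ x) ^ 2) ∩ Ω) :=
        ((hφ.continuous.pow 2).isOpen_support).inter ho
      refine hopen.measure_pos _ ⟨x0, ?_, hx0⟩
      have : φ x0 = 1 := φ.one_of_mem_closedBall (by simp [φ.rIn_pos.le])
      simp [this]
    · exact Filter.Eventually.of_forall fun x => sq_nonneg _
    · exact hphisq.integrableOn
  refine ⟨max 1 (D / (√(deriv f d) * E)), ?_⟩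
  intro lam u hl hs hup hst
  by_cases hl1 : lam < 1
  · exact le_trans (Real.sqrt_le_one.2 hl1.le) (le_max_left _ _)
  push Not at hl1
  apply le_trans _ (le_max_right _ _)
  obtain ⟨hu, hua, heq, hu0, hv0⟩ := hs
  have hv : ContDiff ℝ (⊤ : ℕ∞) (fun x => (-1) * lap u x) := contDiff_const.mul (contDiff_lap hu)
  have hlv : ∀ x ∈ Ω, lap (fun x => (-1) * lap u x) x ≤ -(lam * f 0) := by
    intro x hx
    rw [lap_neg (contDiff_lap hu), heq x hx]
    have := f_mono hf le_rfl (hua x hx).1 (hua x hx).2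
    nlinarith
  have hvnn : ∀ x ∈ Ω, 0 ≤ (-1) * lap u x := by
    apply max_principle ho hb hv
    · intro x hx
      have h1 := hlv x hx
      have : 0 < lam * f 0 := by positivity
      linarith
    · intro x hx; rw [hv0 x hx]; simp
  have hv2 := ball_comparison hR' hv (d := lam * f 0) (by positivity)
    (fun x hx => hlv x (hRs (Metric.ball_subset_closedBall hx))) (fun x hx => hvnn x (hRs hx))
  have hu2 := ball_comparison (x0 := x0) (R := R/2) (by positivity) hu (d := lam * f 0 * k1) (by positivity)
    (fun x hx => by have := hv2 x hx; linarith) (fun x hx => (hua x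
      (hRs (Metric.closedBall_subset_closedBall (by linarith) hx))).1)
  have hu3 : ∀ x ∈ Metric.ball x0 (R/4), d ≤ u x := by
    intro x hx
    have h1 := hu2 x (by convert hx using 2; ring)
    have : d ≤ lam * d := by nlinarith
    rw [← hk2] at h1
    calc d ≤ lam * d := this
      _ = lam * f 0 * k1 * k2 := by rw [hd]; ring
      _ ≤ u x := h1
  have hdd : d ∈ dom0 a := ⟨hdp, lta_of_le (hu3 x0 (Metric.mem_ball_self (by positivity))) (hua x0 hx0).2⟩
  have hst1 := hst φ hφ φ.hasCompactSupport (hφO.trans hbO)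
  have hfd := fd_pos hf hdd
  rw [le_div_iff₀ (by positivity)]
  refine le_trans ?_ hst1
  refine mul_le_mul_of_nonneg_left ?_ (Real.sqrt_nonneg _)
  rw [hE, ← integral_const_mul]
  have hcs : ContinuousOn (fun x => √(deriv f (u x)) * φ x ^ 2) Ω := by
    apply ContinuousOn.mul _ (hφ.continuous.pow 2).continuousOn
    intro x hx
    have h1 : ContinuousAt (deriv f) (u x) := (contDiffAt_deriv (f_contDiffAt hf ⟨hup x hx, (hua x hx).2⟩)).continuousAt
    have h2 : ContinuousAt (fun x => deriv f (u x)) x := ContinuousAt.comp (f := u) h1 hu.continuous.continuousAt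
    exact (h2.sqrt).continuousWithinAt
  refine setIntegral_mono_on (hphisq.integrableOn.const_mul _) ?_ ho.measurableSet ?_
  · have h1 : IntegrableOn (fun x => √(deriv f (u x)) * φ x ^ 2) (tsupport φ) :=
      (hcs.mono (hφO.trans hbO)).integrableOn_compact φ.hasCompactSupport
    refine h1.of_forall_sdiff_eq_zero ho.measurableSet ?_
    rintro x ⟨_, hx⟩
    rw [image_eq_zero_of_notMem_tsupport hx]; simp
  · intro x hx
    by_cases hxs : x ∈ Metric.ball x0 (R/4)
    · refine mul_le_mul_of_nonneg_right (Real.sqrt_le_sqrt ?_) (sq_nonneg _)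
      exact fd_mono hf hdd ⟨hup x hx, (hua x hx).2⟩ (hu3 x hxs)
    · have : φ x = 0 := image_eq_zero_of_notMem_tsupport fun h => hxs (hφO h)
      rw [this]; simp

lemma cut1d {a : EReal} {M : ℝ} (hM : M ∈ dom0 a) {g : ℝ → ℝ}
    (hg : ∀ t ∈ dom0 a, ContDiffAt ℝ (⊤ : ℕ∞) g t) :
    ∃ h H : ℝ → ℝ, (∀ t : ℝ, (t : EReal) < a → ContDiffAt ℝ (⊤ : ℕ∞) h t) ∧
      (∀ t ≤ M / 2, h t = 0) ∧ (∀ t, M ≤ t → h t = g t) ∧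
      (∀ t : ℝ, (t : EReal) < a → ContDiffAt ℝ (⊤ : ℕ∞) H t) ∧
      (∀ t ≤ M / 2, H t = 0) ∧
      (∀ t : ℝ, (t : EReal) < a → deriv H t = (deriv h t) ^ 2) ∧
      (∀ t : ℝ, (t : EReal) < a → 0 ≤ H t) ∧ (∀ t ≤ M, H t ≤ H M) ∧
      (∀ k k' : ℝ → ℝ, (∀ t : ℝ, M ≤ t → (t : EReal) < a → HasDerivAt k (k' t) t ∧
        (deriv g t) ^ 2 ≤ k' t) → ∀ t : ℝ, M ≤ t → (t : EReal) < a → H t ≤ H M + k t - k M) := by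
  have hM0 := hM.1
  set h : ℝ → ℝ := fun t => smoothTransition ((t - M / 2) / (M / 2)) * g t with hh
  have hh0 : ∀ t ≤ M / 2, h t = 0 := fun t ht => by
    simp only [hh]
    rw [smoothTransition.zero_of_nonpos, zero_mul]
    exact div_nonpos_of_nonpos_of_nonneg (by linarith) (by linarith)
  have hh1 : ∀ t, M ≤ t → h t = g t := fun t ht => by
    simp only [hh]
    rw [smoothTransition.one_of_one_le, one_mul]
    rw [le_div_iff₀ (by linarith)]; linarith
  have hS := isOpen_lta a
  have hhc : ∀ t : ℝ, (t : EReal) < a → ContDiffAt ℝ (⊤ : ℕ∞) h t := by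
    intro t ht
    rcases lt_or_ge 0 t with h0 | h0
    · have h1 : ContDiffAt ℝ (⊤ : ℕ∞) (fun t : ℝ => smoothTransition ((t - M / 2) / (M / 2))) t := by
        have : ContDiff ℝ (⊤ : ℕ∞) (fun t : ℝ => smoothTransition ((t - M / 2) / (M / 2))) :=
          smoothTransition.contDiff.comp ((contDiff_id.sub contDiff_const).div_const _)
        exact this.contDiffAt
      exact h1.mul (hg t ⟨h0, ht⟩)
    · refine (contDiffAt_const (c := (0:ℝ))).congr_of_eventuallyEq ?_
      filter_upwards [Iio_mem_nhds (show t < M / 2 by linarith)] with s hs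
      exact hh0 s (le_of_lt hs)
  set q : ℝ → ℝ := fun t => (deriv h t) ^ 2 with hq
  have hqc : ∀ t : ℝ, (t : EReal) < a → ContDiffAt ℝ (⊤ : ℕ∞) q t := fun t ht =>
    (contDiffAt_deriv (hhc t ht)).pow 2
  have hqcont : ContinuousOn q {t : ℝ | (t : EReal) < a} := fun t ht =>
    (hqc t ht).continuousAt.continuousWithinAt
  set H : ℝ → ℝ := fun t => ∫ s in (M/2)..t, q s with hH
  have hm2 : ((M / 2 : ℝ) : EReal) < a := lta_of_le (by linarith) hM.2
  have hint : ∀ s t : ℝ, (s : EReal) < a → (t : EReal) < a → IntervalIntegrable q volume s t := by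
    intro s t hs ht
    apply ContinuousOn.intervalIntegrable
    refine hqcont.mono fun r hr => ?_
    have : r ≤ max s t := hr.2
    rcases le_max_iff.1 this with h | h
    · exact lta_of_le h hs
    · exact lta_of_le h ht
  have hHd : ∀ t : ℝ, (t : EReal) < a → HasDerivAt H (q t) t := by
    intro t ht
    exact intervalIntegral.integral_hasDerivAt_right (hint _ _ hm2 ht)
      (hqcont.stronglyMeasurableAtFilter hS t ht) (hqc t ht).continuousAt
  have hHc : ContDiffOn ℝ (⊤ : ℕ∞) H {t : ℝ | (t : EReal) < a} := by
    rw [contDiffOn_infty_iff_deriv_of_isOpen hS]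
    refine ⟨fun t ht => (hHd t ht).differentiableAt.differentiableWithinAt, ?_⟩
    have : ContDiffOn ℝ (⊤ : ℕ∞) q {t : ℝ | (t : EReal) < a} := fun t ht =>
      (hqc t ht).contDiffWithinAt
    exact this.congr fun t ht => (hHd t ht).deriv
  have hqnn : ∀ t, 0 ≤ q t := fun t => sq_nonneg _
  have hq0 : ∀ t < M / 2, q t = 0 := by
    intro t ht
    have : h =ᶠ[𝓝 t] fun _ => 0 := by
      filter_upwards [Iio_mem_nhds ht] with s hs
      exact hh0 s (le_of_lt hs)
    simp only [hq, this.deriv_eq]; simp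
  have hH0 : ∀ t ≤ M / 2, H t = 0 := by
    intro t ht
    simp only [hH]
    rw [intervalIntegral.integral_symm, intervalIntegral.integral_of_le ht, neg_eq_zero,
      integral_Ioc_eq_integral_Ioo]
    exact setIntegral_eq_zero_of_forall_eq_zero fun s hs => hq0 s hs.2
  have hHmono : ∀ s t : ℝ, s ≤ t → (t : EReal) < a → H s ≤ H t := by
    intro s t hst ht
    have hs := lta_of_le hst ht
    have : H t - H s = ∫ r in s..t, q r :=
      intervalIntegral.integral_interval_sub_left (hint _ _ hm2 ht) (hint _ _ hm2 hs)
    have h2 : 0 ≤ ∫ r in s..t, q r := intervalIntegral.integral_nonneg hst fun r _ => hqnn r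
    linarith
  refine ⟨h, H, hhc, hh0, hh1, fun t ht => hHc.contDiffAt (hS.mem_nhds ht), hH0,
    fun t ht => (hHd t ht).deriv, ?_, fun t ht => hHmono t M ht hM.2, ?_⟩
  · intro t ht
    rcases le_total t (M/2) with h1 | h1
    · rw [hH0 t h1]
    · have := hHmono _ _ h1 ht
      rw [hH0 _ le_rfl] at this; exact this
  · intro k k' hk t hMt hta
    have hder : ∀ s ∈ Icc M t, HasDerivAt (fun s => H s - k s) (q s - k' s) s := fun s hs =>
      (hHd s (lta_of_le hs.2 hta)).sub (hk s hs.1 (lta_of_le hs.2 hta)).1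
    have hanti : AntitoneOn (fun s => H s - k s) (Icc M t) := by
      apply antitoneOn_of_deriv_nonpos (convex_Icc _ _)
      · exact fun s hs => (hder s hs).continuousAt.continuousWithinAt
      · exact fun s hs => (hder s (interior_subset hs)).differentiableAt.differentiableWithinAt
      · intro s hs
        rw [(hder s (interior_subset hs)).deriv]
        rw [interior_Icc] at hs
        have : h =ᶠ[𝓝 s] g := by
          filter_upwards [Ioi_mem_nhds hs.1] with r hr
          exact hh1 r (le_of_lt hr)
        have h2 := (hk s hs.1.le (lta_of_le hs.2.le hta)).2
        simp only [hq, this.deriv_eq]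
        linarith
    have := hanti ⟨le_rfl, hMt⟩ ⟨hMt, le_rfl⟩ hMt
    simp only at this
    linarith

/-- The weighted quotient of the shifted nonlinearity by the root of its derivative. -/
def Qf (f : ℝ → ℝ) (t : ℝ) : ℝ := ftil f t / √(deriv f t)

/-- The local quotient whose limits are the two tau constants. -/
def rf (f : ℝ → ℝ) (t : ℝ) : ℝ := ftil f t * deriv (deriv f) t / (deriv f t) ^ 2

lemma ftil_hasDerivAt {a : EReal} {f : ℝ → ℝ} (hf : HypH a f) {t : ℝ} (ht : t ∈ dom0 a) :
    HasDerivAt (ftil f) (deriv f t) t := (f_hasDerivAt hf ht).sub_const _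

lemma fd_hasDerivAt {a : EReal} {f : ℝ → ℝ} (hf : HypH a f) {t : ℝ} (ht : t ∈ dom0 a) :
    HasDerivAt (deriv f) (deriv (deriv f) t) t :=
  ((contDiffAt_deriv (f_contDiffAt hf ht)).differentiableAt (by simp)).hasDerivAt

lemma Qf_pos {a : EReal} {f : ℝ → ℝ} (hf : HypH a f) {t : ℝ} (ht : t ∈ dom0 a) : 0 < Qf f t :=
  div_pos (ftil_pos hf ht) (Real.sqrt_pos.2 (fd_pos hf ht))

lemma Qf_hasDerivAt {a : EReal} {f : ℝ → ℝ} (hf : HypH a f) {t : ℝ} (ht : t ∈ dom0 a) :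
    HasDerivAt (Qf f) (√(deriv f t) * (1 - rf f t / 2)) t := by
  have hp := fd_pos hf ht
  have hs := Real.sqrt_pos.2 hp
  have h1 := (ftil_hasDerivAt hf ht).div ((fd_hasDerivAt hf ht).sqrt hp.ne') hs.ne'
  refine h1.congr_deriv ?_
  unfold rf
  have hsq : deriv f t = √(deriv f t) ^ 2 := (Real.sq_sqrt hp.le).symm
  set s := √(deriv f t)
  rw [hsq]
  field_simp

lemma Qf_contDiffAt {a : EReal} {f : ℝ → ℝ} (hf : HypH a f) {t : ℝ} (ht : t ∈ dom0 a) :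
    ContDiffAt ℝ (⊤ : ℕ∞) (Qf f) t := by
  have hp := fd_pos hf ht
  have hs := Real.sqrt_pos.2 hp
  exact ((f_contDiffAt hf ht).sub contDiffAt_const).div
    ((contDiffAt_deriv (f_contDiffAt hf ht)).sqrt hp.ne') hs.ne'

lemma psi_sq_deriv {a : EReal} {f : ℝ → ℝ} (hf : HypH a f) (α : ℝ) {t : ℝ} (ht : t ∈ dom0 a) :
    (deriv (fun t => Qf f t ^ α) t) ^ 2 =
      Qf f t ^ (2 * α - 2) * deriv f t * (α ^ 2 * (1 - rf f t / 2) ^ 2) := by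
  have hQ := Qf_pos hf ht
  have h1 := (Qf_hasDerivAt hf ht).rpow_const (p := α) (Or.inl hQ.ne')
  rw [h1.deriv]
  have e : Qf f t ^ (2 * α - 2) = (Qf f t ^ (α - 1)) ^ 2 := by
    rw [← Real.rpow_natCast, ← Real.rpow_mul hQ.le]; congr 1; push_cast; ring
  rw [e]
  have hsq : deriv f t = √(deriv f t) ^ 2 := (Real.sq_sqrt (fd_pos hf ht).le).symm
  set s := √(deriv f t)
  rw [hsq]
  ring

lemma k_hasDerivAt {a : EReal} {f : ℝ → ℝ} (hf : HypH a f) (α A : ℝ) {t : ℝ} (ht : t ∈ dom0 a) :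
    HasDerivAt (fun t => A * (√(deriv f t) * Qf f t ^ (2 * α - 1)))
      (Qf f t ^ (2 * α - 2) * deriv f t * (A * ((2 * α - 1) - (α - 1) * rf f t))) t := by
  have hQ := Qf_pos hf ht
  have hp := fd_pos hf ht
  have hs := Real.sqrt_pos.2 hp
  have h1 := (Qf_hasDerivAt hf ht).rpow_const (p := 2 * α - 1) (Or.inl hQ.ne')
  have h2 := (((fd_hasDerivAt hf ht).sqrt hp.ne').mul h1).const_mul A
  refine h2.congr_deriv ?_
  have e : Qf f t ^ (2 * α - 1) = Qf f t ^ (2 * α - 2) * Qf f t := by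
    rw [← Real.rpow_add_one hQ.ne']; congr 1; ring
  have e2 : (2 * α - 1 - 1) = 2 * α - 2 := by ring
  rw [e, e2]
  set P := Qf f t ^ (2 * α - 2)
  unfold rf Qf
  have hsq : deriv f t = √(deriv f t) ^ 2 := (Real.sq_sqrt hp.le).symm
  set s := √(deriv f t)
  rw [hsq]
  field_simp
  ring

lemma young_p {p x y : ℝ} (hp : 1 < p) (hx : 0 ≤ x) (hy : 0 ≤ y) :
    x ^ (p - 1) * y ≤ (1 - 1 / p) * x ^ p + 1 / p * y ^ p := by
  have hp0 : 0 < p := by linarith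
  have h1 : 1 / p ≤ 1 := by rw [div_le_one hp0]; exact hp.le
  have h := Real.geom_mean_le_arith_mean2_weighted (w₁ := 1 - 1/p) (w₂ := 1/p) (p₁ := x ^ p)
    (p₂ := y ^ p) (by linarith) (by positivity) (by positivity) (by positivity) (by ring)
  rw [← Real.rpow_mul hx, ← Real.rpow_mul hy] at h
  have e1 : p * (1 - 1 / p) = p - 1 := by field_simp
  have e2 : p * (1 / p) = 1 := by field_simp
  rwa [e1, e2, Real.rpow_one] at h

lemma core_ineq {p A B c2 c2' κ : ℝ} (hp : 1 < p) (hA : 0 < A) (hB : 0 < B) (hc2' : 0 ≤ c2')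
    (hκ : 0 < κ) (h1 : c2' * B ^ p / p + 2 * κ ≤ 1 / p)
    (h2 : A ^ p / p + c2' * (1 - 1 / p) ≤ c2) (C1 C0 : ℝ) :
    ∃ Q0 : ℝ, ∀ Q s : ℝ, Q0 ≤ Q → 0 ≤ s →
      A * (Q ^ (p - 1) * s) + c2' * (B * (Q * s ^ (p - 1))) + C1 * Q + C0 ≤
        (1 - κ) * Q ^ p + c2 * s ^ p := by
  set N : ℝ := (|C1| + |C0|) / κ with hN
  have hN0 : 0 ≤ N := by positivity
  have hp1 : 0 < p - 1 := by linarith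
  refine ⟨max 1 (N ^ (1 / (p - 1))), ?_⟩
  intro Q s hQ hs
  have hQ1 : 1 ≤ Q := le_trans (le_max_left _ _) hQ
  have hQ2 : N ^ (1 / (p - 1)) ≤ Q := le_trans (le_max_right _ _) hQ
  have hQN : N ≤ Q ^ (p - 1) := by
    calc N = (N ^ (1 / (p - 1))) ^ (p - 1) := by
          rw [← Real.rpow_mul hN0]; rw [one_div_mul_cancel hp1.ne', Real.rpow_one]
      _ ≤ Q ^ (p - 1) := Real.rpow_le_rpow (by positivity) hQ2 hp1.le
  have hQp : Q ^ p = Q ^ (p - 1) * Q := by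
    rw [← Real.rpow_add_one (by linarith)]; congr 1; ring
  have y1 := young_p hp (x := Q) (y := A * s) (by linarith) (by positivity)
  have y2 := young_p hp (x := s) (y := B * Q) hs (by positivity)
  rw [Real.mul_rpow hA.le hs] at y1
  rw [Real.mul_rpow hB.le (by linarith)] at y2
  have y2' := mul_le_mul_of_nonneg_left y2 hc2'
  have hlow : C1 * Q + C0 ≤ κ * Q ^ p := by
    have e : κ * N = |C1| + |C0| := by rw [hN]; field_simp
    have h3 : κ * N * Q ≤ κ * Q ^ (p-1) * Q :=
      mul_le_mul_of_nonneg_right (mul_le_mul_of_nonneg_left hQN hκ.le) (by linarith)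
    rw [e] at h3
    have h4 : C1 * Q ≤ |C1| * Q := mul_le_mul_of_nonneg_right (le_abs_self _) (by linarith)
    have h5 : C0 ≤ |C0| * Q := (le_abs_self _).trans (le_mul_of_one_le_right (abs_nonneg _) hQ1)
    rw [hQp]; nlinarith
  have hQpp : 0 ≤ Q ^ p := by positivity
  have hsp : 0 ≤ s ^ p := by positivity
  have k1 := mul_le_mul_of_nonneg_right h1 hQpp
  have k2 := mul_le_mul_of_nonneg_right h2 hsp
  have e3 : (c2' * B ^ p / p + 2 * κ) * Q ^ p = c2' * (1 / p * (B ^ p * Q ^ p)) + 2 * (κ * Q ^ p) := by ring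
  have e4 : (A ^ p / p + c2' * (1 - 1 / p)) * s ^ p = 1 / p * (A ^ p * s ^ p) + c2' * ((1 - 1/p) * s ^ p) := by ring
  rw [e3] at k1
  rw [e4] at k2
  have e5 : A * (Q ^ (p - 1) * s) = Q ^ (p - 1) * (A * s) := by ring
  have e6 : c2' * (B * (Q * s ^ (p - 1))) = c2' * (s ^ (p - 1) * (B * Q)) := by ring
  have e7 : c2' * ((1 - 1 / p) * s ^ p + 1 / p * (B ^ p * Q ^ p)) =
    c2' * ((1 - 1 / p) * s ^ p) + c2' * (1 / p * (B ^ p * Q ^ p)) := by ring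
  rw [e5, e6]
  rw [e7] at y2'
  have e8 : (1 - 1 / p) * Q ^ p = Q ^ p - 1 / p * Q ^ p := by ring
  have e9 : (1 - κ) * Q ^ p = Q ^ p - κ * Q ^ p := by ring
  rw [e8] at y1
  rw [e9]
  linarith

lemma poly_ineq {p c : ℝ} (hp : 2 ≤ p) (hc : 0 < c) (D1 D2 : ℝ) :
    ∃ C : ℝ, 0 ≤ C ∧ ∀ s : ℝ, 0 ≤ s → D1 * s + D2 * s ^ (p - 1) ≤ c * s ^ p + C := by
  set S : ℝ := max 1 ((|D1| + |D2|) / c) with hS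
  have hS1 : 1 ≤ S := le_max_left _ _
  refine ⟨|D1| * S + |D2| * S ^ (p - 1), by positivity, ?_⟩
  intro s hs
  have hsp : 0 ≤ s ^ p := by positivity
  have a1 : D1 * s ≤ |D1| * s := mul_le_mul_of_nonneg_right (le_abs_self _) hs
  have a2 : D2 * s ^ (p-1) ≤ |D2| * s ^ (p-1) :=
    mul_le_mul_of_nonneg_right (le_abs_self _) (by positivity)
  rcases le_total s S with h | h
  · have b1 : |D1| * s ≤ |D1| * S := mul_le_mul_of_nonneg_left h (abs_nonneg _)
    have b2 : |D2| * s ^ (p-1) ≤ |D2| * S ^ (p-1) :=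
      mul_le_mul_of_nonneg_left (Real.rpow_le_rpow hs h (by linarith)) (abs_nonneg _)
    nlinarith
  · have hs1 : 1 ≤ s := hS1.trans h
    have hsp : s ^ p = s ^ (p - 1) * s := by
      rw [← Real.rpow_add_one (by linarith)]; congr 1; ring
    have b1 : s ≤ s ^ (p - 1) := by
      nth_rewrite 1 [← Real.rpow_one s]
      exact Real.rpow_le_rpow_of_exponent_le hs1 (by linarith)
    have b2 : |D1| + |D2| ≤ c * s := by
      have := (le_max_right 1 ((|D1| + |D2|) / c)).trans h
      rw [div_le_iff₀ hc] at this; linarith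
    have b3 : (|D1| + |D2|) * s ^ (p-1) ≤ c * s * s ^ (p-1) :=
      mul_le_mul_of_nonneg_right b2 (by positivity)
    have b4 : |D1| * s ≤ |D1| * s ^ (p-1) := mul_le_mul_of_nonneg_left b1 (abs_nonneg _)
    have : 0 ≤ |D1| * S + |D2| * S ^ (p - 1) := by positivity
    rw [hsp]; nlinarith

lemma exists_consts {p A B K : ℝ} (hp : 1 < p) (hA : 0 < A) (hB : 0 < B) (hAB : A * B < 1)
    (hK : 0 ≤ K) : ∃ c2 δ κ : ℝ, 0 < c2 ∧ 0 < δ ∧ 0 < κ ∧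
      (c2 + δ * K) * ((1 + δ) * B) ^ p / p + 2 * κ ≤ 1 / p ∧
      A ^ p / p + (c2 + δ * K) * (1 - 1 / p) ≤ c2 := by
  have hp0 : 0 < p := by linarith
  have hBp : 0 < B ^ p := by positivity
  have h1 : A ^ p < 1 / B ^ p := by
    rw [lt_div_iff₀ hBp, ← Real.mul_rpow hA.le hB.le]
    exact Real.rpow_lt_one (by positivity) hAB hp0
  obtain ⟨c2, hc1, hc2⟩ := exists_between h1
  have hc2p : 0 < c2 := lt_trans (by positivity) hc1
  rw [lt_div_iff₀ hBp] at hc2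
  have hcont1 : ContinuousAt (fun δ : ℝ => (c2 + δ * K) * ((1 + δ) * B) ^ p) 0 := by
    apply ContinuousAt.mul (by fun_prop)
    apply ContinuousAt.rpow_const (by fun_prop)
    right; exact hp0.le
  have hcont2 : ContinuousAt (fun δ : ℝ => A ^ p / p + (c2 + δ * K) * (1 - 1 / p)) 0 := by fun_prop
  have ev1 : ∀ᶠ δ in 𝓝 (0:ℝ), (c2 + δ * K) * ((1 + δ) * B) ^ p < 1 :=
    hcont1.eventually_lt continuousAt_const (by simpa using hc2)
  have ev2 : ∀ᶠ δ in 𝓝 (0:ℝ), A ^ p / p + (c2 + δ * K) * (1 - 1 / p) < c2 := by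
    apply hcont2.eventually_lt continuousAt_const
    have : A ^ p / p < c2 / p := div_lt_div_of_pos_right hc1 hp0
    have e : (c2 + 0 * K) * (1 - 1/p) = c2 - c2 / p := by ring
    rw [e]; linarith
  have ev : ∀ᶠ δ in 𝓝[>] (0:ℝ), 0 < δ := self_mem_nhdsWithin
  obtain ⟨δ, ⟨h3, h4⟩, h5⟩ := (((ev1.and ev2).filter_mono nhdsWithin_le_nhds).and ev).exists
  refine ⟨c2, δ, (1 - (c2 + δ * K) * ((1 + δ) * B) ^ p) / (2 * p), hc2p, h5, ?_, ?_, h4.le⟩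
  · apply div_pos <;> linarith
  · apply le_of_eq; field_simp; ring

lemma f_setup {a : EReal} {f : ℝ → ℝ} (hf : HypH a f)
    (hτm : 0 < tauMinus a f) (hττ : tauMinus a f ≤ tauPlus a f) (hτp : tauPlus a f < 2)
    {α : ℝ} (hα : 1 < α) (hPα : Pf (tauMinus a f) (tauPlus a f) α < 0) :
    ∃ A : ℝ, 0 < A ∧ A * (α ^ 2 / (2 * α - 1)) < 1 ∧ ∀ Q0 ε : ℝ, 0 < ε → ∃ M ∈ dom0 a,
      ∀ t : ℝ, M ≤ t → (t : EReal) < a →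
        α ^ 2 * (1 - rf f t / 2) ^ 2 ≤ A * ((2 * α - 1) - (α - 1) * rf f t) ∧
        Q0 ≤ Qf f t ∧ f t ≤ (1 + ε) * ftil f t := by
  set τm := tauMinus a f with hτmd
  set τp := tauPlus a f with hτpd
  have ev1 : ∀ᶠ δ in 𝓝 (0:ℝ), Pf (τm - δ) (τp + δ) α < 0 := by
    have : ContinuousAt (fun δ : ℝ => Pf (τm - δ) (τp + δ) α) 0 := by unfold Pf; fun_prop
    exact this.eventually_lt continuousAt_const (by simpa using hPα)
  have ev2 : ∀ᶠ δ in 𝓝 (0:ℝ), δ < τm := Iio_mem_nhds hτm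
  have ev3 : ∀ᶠ δ in 𝓝 (0:ℝ), δ < 2 - τp := Iio_mem_nhds (by linarith)
  have ev : ∀ᶠ δ in 𝓝[>] (0:ℝ), 0 < δ := self_mem_nhdsWithin
  obtain ⟨δ, ⟨h1, h2, h3⟩, hδ⟩ :=
    (((ev1.and (ev2.and ev3)).filter_mono nhdsWithin_le_nhds).and ev).exists
  set σm := τm - δ with hσm
  set σp := τp + δ with hσp
  have hσm0 : 0 < σm := by linarith
  have hσp2 : σp < 2 := by linarith
  have hσ : σm < σp := by linarith
  have hden : 0 < (2 * α - 1) - (α - 1) * σp := by nlinarith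
  have hden2 : 0 < 2 * α - 1 := by linarith
  set A := α ^ 2 * (1 - σm / 2) ^ 2 / ((2 * α - 1) - (α - 1) * σp) with hA
  have hm2 : 0 < 1 - σm / 2 := by linarith
  have hAp : 0 < A := by positivity
  have hF : Tendsto (ftil f) (afFilter a) atTop := tendsto_atTop_add_const_right _ _ hf.blowup
  -- bounds for the quotient `rf`
  have hev : ∀ᶠ t in afFilter a, t ∈ dom0 a → σm ≤ rf f t ∧ rf f t ≤ σp := by
    have hτ' : σm < τm - δ / 2 := by linarith
    set θ := σm / (τm - δ / 2) with hθ
    have hd2 : 0 < τm - δ / 2 := by linarith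
    have hθ1 : θ < 1 := by rw [hθ, div_lt_one hd2]; exact hτ'
    filter_upwards [tau_minus_ev (s := τm - δ / 2) hτm (by linarith),
      tau_plus_ev (a := a) (f := f) (s := σp) (by linarith) (by linarith),
      hf.blowup.eventually_ge_atTop (f 0 / (1 - θ))] with t ha hb hc ht
    have hfp := hf.pos t (dom0_sub a ht)
    have hft := ftil_pos hf ht
    have e : rf f t = (ftil f t / f t) * (f t * deriv (deriv f) t / (deriv f t) ^ 2) := by
      unfold rf; field_simp
    have hq1 : ftil f t / f t ≤ 1 := by
      rw [div_le_one hfp]; unfold ftil; linarith [hf.f0_pos]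
    have hq2 : θ ≤ ftil f t / f t := by
      rw [le_div_iff₀ hfp]
      rw [div_le_iff₀ (by linarith)] at hc
      unfold ftil; linarith
    have hq0 : 0 ≤ ftil f t / f t := by positivity
    have hθe : θ * (τm - δ / 2) = σm := by rw [hθ]; exact div_mul_cancel₀ _ hd2.ne'
    rw [e]
    constructor
    · rw [← hθe]
      exact mul_le_mul hq2 ha.le hd2.le hq0
    · calc _ ≤ 1 * (f t * deriv (deriv f) t / (deriv f t) ^ 2) :=
            mul_le_mul_of_nonneg_right hq1 (by linarith)
        _ ≤ σp := by rw [one_mul]; exact hb.le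
  obtain ⟨M1, hM1, hr⟩ := af_eventually hf.a_pos hev
  have hr' : ∀ t, M1 ≤ t → (t : EReal) < a → t ∈ dom0 a ∧ σm ≤ rf f t ∧ rf f t ≤ σp :=
    fun t h1 h2 => ⟨⟨hM1.1.trans_le h1, h2⟩, hr t h1 h2 ⟨hM1.1.trans_le h1, h2⟩⟩
  refine ⟨A, hAp, ?_, ?_⟩
  · rw [hA, div_mul_div_comm, div_lt_one (by positivity)]
    unfold Pf at h1
    nlinarith
  intro Q0 ε hε
  -- growth of `Qf`
  set N : ℝ → ℝ := fun t => deriv f t * ftil f t ^ (-σp) with hN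
  have hNanti : ∀ t, M1 ≤ t → (t : EReal) < a → N t ≤ N M1 := by
    intro t hMt hta
    have hder : ∀ s ∈ Icc M1 t, HasDerivAt N (ftil f s ^ (-σp - 1) *
        ((rf f s - σp) * (deriv f s) ^ 2)) s := by
      intro s hs
      have hsd := (hr' s hs.1 (lta_of_le hs.2 hta)).1
      have hFp := ftil_pos hf hsd
      have hdp := fd_pos hf hsd
      have := (fd_hasDerivAt hf hsd).mul ((ftil_hasDerivAt hf hsd).rpow_const (p := -σp) (Or.inl hFp.ne'))
      refine this.congr_deriv ?_
      have e : ftil f s ^ (-σp) = ftil f s ^ (-σp - 1) * ftil f s := by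
        rw [← Real.rpow_add_one hFp.ne']; congr 1; ring
      rw [e]; unfold rf; field_simp; ring
    have hanti : AntitoneOn N (Icc M1 t) := by
      apply antitoneOn_of_deriv_nonpos (convex_Icc _ _)
      · exact fun s hs => (hder s hs).continuousAt.continuousWithinAt
      · exact fun s hs => (hder s (interior_subset hs)).differentiableAt.differentiableWithinAt
      · intro s hs
        have hs' := interior_subset hs
        rw [(hder s hs').deriv]
        have hsd := hr' s hs'.1 (lta_of_le hs'.2 hta)
        have hFp := ftil_pos hf hsd.1
        apply mul_nonpos_of_nonneg_of_nonpos (by positivity)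
        exact mul_nonpos_of_nonpos_of_nonneg (by linarith [hsd.2.2]) (sq_nonneg _)
    exact hanti ⟨le_rfl, hMt⟩ ⟨hMt, le_rfl⟩ hMt
  have hNp : 0 < N M1 := mul_pos (fd_pos hf hM1) (Real.rpow_pos_of_pos (ftil_pos hf hM1) _)
  have hev2 : ∀ᶠ t in afFilter a, N M1 * Q0 ^ 2 ≤ ftil f t ^ (2 - σp) ∧ f 0 / ε ≤ ftil f t :=
    (((tendsto_rpow_atTop (by linarith)).comp hF).eventually_ge_atTop _).and
      (hF.eventually_ge_atTop _)
  obtain ⟨M2, hM2, hr2⟩ := af_eventually hf.a_pos hev2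
  have hMM : max M1 M2 ∈ dom0 a := by
    rcases max_choice M1 M2 with h | h <;> rw [h] <;> assumption
  refine ⟨max M1 M2, hMM, ?_⟩
  intro t ht hta
  obtain ⟨htd, hrm, hrp⟩ := hr' t ((le_max_left _ _).trans ht) hta
  obtain ⟨g1, g2⟩ := hr2 t ((le_max_right _ _).trans ht) hta
  have hFp := ftil_pos hf htd
  have hdp := fd_pos hf htd
  refine ⟨?_, ?_, ?_⟩
  · have b1 : (1 - rf f t / 2) ^ 2 ≤ (1 - σm / 2) ^ 2 :=
      pow_le_pow_left₀ (by linarith) (by linarith) 2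
    have b2 : (2 * α - 1) - (α - 1) * σp ≤ (2 * α - 1) - (α - 1) * rf f t := by nlinarith
    calc α ^ 2 * (1 - rf f t / 2) ^ 2 ≤ α ^ 2 * (1 - σm / 2) ^ 2 :=
          mul_le_mul_of_nonneg_left b1 (sq_nonneg _)
      _ = A * ((2 * α - 1) - (α - 1) * σp) := by rw [hA, div_mul_cancel₀ _ hden.ne']
      _ ≤ _ := mul_le_mul_of_nonneg_left b2 hAp.le
  · have b1 := hNanti t ((le_max_left _ _).trans ht) hta
    have e1 : N t = deriv f t / ftil f t ^ σp := by
      simp only [hN]; rw [Real.rpow_neg hFp.le, div_eq_mul_inv]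
    have e2 : ftil f t ^ (2 - σp) = ftil f t ^ 2 / ftil f t ^ σp := by
      rw [Real.rpow_sub hFp, Real.rpow_two]
    have hFσ : 0 < ftil f t ^ σp := by positivity
    rw [e1, div_le_iff₀ hFσ] at b1
    rw [e2, le_div_iff₀ hFσ] at g1
    have b2 : deriv f t * Q0 ^ 2 ≤ ftil f t ^ 2 := by nlinarith [sq_nonneg Q0]
    unfold Qf
    rw [le_div_iff₀ (Real.sqrt_pos.2 hdp)]
    apply le_of_sq_le_sq _ hFp.le
    rw [mul_pow, Real.sq_sqrt hdp.le]; linarith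
  · rw [div_le_iff₀ hε] at g2
    unfold ftil at g2 ⊢
    linarith

lemma eta_setup {α : ℝ} (hα : 1 < α) : ∃ (η G : ℝ → ℝ) (C1 : ℝ), 0 ≤ C1 ∧
    (∀ t, ContDiffAt ℝ (⊤ : ℕ∞) η t) ∧ (∀ t ≤ 1, η t = 0) ∧
    (∀ t, ContDiffAt ℝ (⊤ : ℕ∞) G t) ∧ (∀ t ≤ 1, G t = 0) ∧
    (∀ t, deriv G t = (deriv η t) ^ 2) ∧ (∀ t, 0 ≤ G t) ∧
    (∀ s, 0 ≤ s → G s ≤ C1 + α ^ 2 / (2 * α - 1) * s ^ (2 * α - 1)) ∧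
    (∀ s, 0 ≤ s → s ^ (2 * α) ≤ η s ^ 2 + 2 ^ (2 * α)) := by
  have hM : (2:ℝ) ∈ dom0 ⊤ := ⟨by norm_num, EReal.coe_lt_top _⟩
  obtain ⟨η, G, h1, h2, h3, h4, h5, h6, h7, h8, h9⟩ := cut1d hM (g := fun s => s ^ α)
    (fun t ht => Real.contDiffAt_rpow_const_of_ne ht.1.ne')
  have h21 : (2:ℝ) / 2 = 1 := by norm_num
  rw [h21] at h2 h5
  have hd : 0 < 2 * α - 1 := by linarith
  refine ⟨η, G, G 2, h7 2 (EReal.coe_lt_top _), fun t => h1 t (EReal.coe_lt_top _), h2,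
    fun t => h4 t (EReal.coe_lt_top _), h5, fun t => h6 t (EReal.coe_lt_top _),
    fun t => h7 t (EReal.coe_lt_top _), ?_, ?_⟩
  · intro s hs
    rcases le_total s 2 with h | h
    · have := h8 s h
      have : 0 ≤ α ^ 2 / (2 * α - 1) * s ^ (2 * α - 1) := by positivity
      linarith [h8 s h]
    · have := h9 (fun s => α ^ 2 / (2 * α - 1) * s ^ (2 * α - 1))
        (fun s => α ^ 2 / (2 * α - 1) * ((2 * α - 1) * s ^ (2 * α - 1 - 1))) (by
          intro t ht _
          have ht0 : 0 < t := by linarith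
          refine ⟨(Real.hasDerivAt_rpow_const (Or.inl ht0.ne')).const_mul _, ?_⟩
          rw [(Real.hasDerivAt_rpow_const (Or.inl ht0.ne')).deriv, mul_pow,
            ← Real.rpow_natCast (t ^ (α - 1)), ← Real.rpow_mul ht0.le]
          apply le_of_eq
          have : (α - 1) * ((2:ℕ):ℝ) = 2 * α - 1 - 1 := by push_cast; ring
          rw [this, ← mul_assoc, div_mul_cancel₀ _ hd.ne']) s h (EReal.coe_lt_top _)
      have h0 : 0 ≤ α ^ 2 / (2 * α - 1) * (2:ℝ) ^ (2 * α - 1) := by positivity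
      linarith
  · intro s hs
    rcases le_total s 2 with h | h
    · have := Real.rpow_le_rpow hs h (by linarith : 0 ≤ 2 * α)
      nlinarith [sq_nonneg (η s)]
    · rw [h3 s h]
      have : (s ^ α) ^ 2 = s ^ (2 * α) := by
        rw [← Real.rpow_natCast, ← Real.rpow_mul hs]; congr 1; push_cast; ring
      simp only [this]
      have : (0:ℝ) ≤ 2 ^ (2 * α) := by positivity
      linarith

lemma Qf_mul_sqrt {a : EReal} {f : ℝ → ℝ} (hf : HypH a f) {t : ℝ} (ht : t ∈ dom0 a) :
    ftil f t = √(deriv f t) * Qf f t := by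
  have := Real.sqrt_pos.2 (fd_pos hf ht)
  unfold Qf; field_simp

lemma psi_setup {a : EReal} {f : ℝ → ℝ} (hf : HypH a f) {α A M : ℝ} (hA : 0 < A)
    (hM : M ∈ dom0 a)
    (hr : ∀ t : ℝ, M ≤ t → (t : EReal) < a →
        α ^ 2 * (1 - rf f t / 2) ^ 2 ≤ A * ((2 * α - 1) - (α - 1) * rf f t)) :
    ∃ (ψ Θ : ℝ → ℝ), (∀ t : ℝ, (t : EReal) < a → ContDiffAt ℝ (⊤ : ℕ∞) ψ t) ∧
      (∀ t ≤ M / 2, ψ t = 0) ∧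
      (∀ t : ℝ, (t : EReal) < a → ContDiffAt ℝ (⊤ : ℕ∞) Θ t) ∧
      (∀ t ≤ M / 2, Θ t = 0) ∧
      (∀ t : ℝ, (t : EReal) < a → deriv Θ t = (deriv ψ t) ^ 2) ∧
      (∀ t : ℝ, (t : EReal) < a → 0 ≤ Θ t) ∧ (∀ t ≤ M, Θ t ≤ Θ M) ∧
      (∀ t : ℝ, M ≤ t → (t : EReal) < a → ψ t ^ 2 = Qf f t ^ (2 * α)) ∧
      (∀ t : ℝ, M ≤ t → (t : EReal) < a →
        Θ t ≤ Θ M + A * (√(deriv f t) * Qf f t ^ (2 * α - 1))) := by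
  obtain ⟨ψ, Θ, h1, h2, h3, h4, h5, h6, h7, h8, h9⟩ := cut1d hM (g := fun s => Qf f s ^ α)
    (fun t ht => (Qf_contDiffAt hf ht).rpow_const_of_ne (Qf_pos hf ht).ne')
  refine ⟨ψ, Θ, h1, h2, h4, h5, h6, h7, h8, ?_, ?_⟩
  · intro t ht hta
    have hq := Qf_pos hf (t := t) ⟨hM.1.trans_le ht, hta⟩
    rw [h3 t ht]
    rw [← Real.rpow_natCast, ← Real.rpow_mul hq.le]; congr 1; push_cast; ring
  · intro t ht hta
    have := h9 _ _ (fun s hs hsa => ⟨k_hasDerivAt hf α A (t := s) ⟨hM.1.trans_le hs, hsa⟩, by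
      have hsd : s ∈ dom0 a := ⟨hM.1.trans_le hs, hsa⟩
      rw [psi_sq_deriv hf α hsd]
      have := fd_pos hf hsd
      have := Qf_pos hf hsd
      exact mul_le_mul_of_nonneg_left (hr s hs hsa) (by positivity)⟩) t ht hta
    have hq := Qf_pos hf hM
    have : 0 ≤ A * (√(deriv f M) * Qf f M ^ (2 * α - 1)) := by positivity
    linarith

lemma pointwise_setup {a : EReal} {f : ℝ → ℝ} (hf : HypH a f)
    (hτm : 0 < tauMinus a f) (hττ : tauMinus a f ≤ tauPlus a f) (hτp : tauPlus a f < 2)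
    {α : ℝ} (hα : 1 < α) (hPα : Pf (tauMinus a f) (tauPlus a f) α < 0) {K : ℝ} (hK : 0 ≤ K)
    {η G : ℝ → ℝ} {C1 : ℝ} (hC1 : 0 ≤ C1) (hη0 : ∀ t ≤ 1, η t = 0) (hG0 : ∀ t ≤ 1, G t = 0)
    (hGn : ∀ t, 0 ≤ G t)
    (hG : ∀ s, 0 ≤ s → G s ≤ C1 + α ^ 2 / (2 * α - 1) * s ^ (2 * α - 1))
    (hη : ∀ s, 0 ≤ s → s ^ (2 * α) ≤ η s ^ 2 + 2 ^ (2 * α)) :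
    ∃ (M c2 δ κ C : ℝ) (ψ Θ : ℝ → ℝ), M ∈ dom0 a ∧ 0 < c2 ∧ 0 < δ ∧ 0 < κ ∧ 
      (∀ t : ℝ, (t : EReal) < a → ContDiffAt ℝ (⊤ : ℕ∞) ψ t) ∧
      (∀ t ≤ M / 2, ψ t = 0) ∧
      (∀ t : ℝ, (t : EReal) < a → ContDiffAt ℝ (⊤ : ℕ∞) Θ t) ∧
      (∀ t ≤ M / 2, Θ t = 0) ∧
      (∀ t : ℝ, (t : EReal) < a → deriv Θ t = (deriv ψ t) ^ 2) ∧
      (∀ t ∈ dom0 a, ftil f t ^ (2 * α) / deriv f t ^ (α - 1 / 2) ≤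
        √(deriv f t) * ψ t ^ 2 + C) ∧
      (∀ t ∈ dom0 a, ∀ s, Θ t * s + (c2 + δ * K) * (G s * f t) + κ * (√(deriv f t) * ψ t ^ 2) ≤
        √(deriv f t) * ψ t ^ 2 + c2 * (√(deriv f t) * η s ^ 2) + δ * η s ^ 2 + C) := by
  obtain ⟨A, hA, hAB, hset⟩ := f_setup hf hτm hττ hτp hα hPα
  have hd : 0 < 2 * α - 1 := by linarith
  have hB : 0 < α ^ 2 / (2 * α - 1) := by positivity
  set B := α ^ 2 / (2 * α - 1) with hBdef
  obtain ⟨c2, δ, κ, hc2, hδ, hκ, hh1, hh2⟩ :=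
    exists_consts (p := 2 * α) (by linarith) hA hB hAB hK
  set c2' := c2 + δ * K with hc2'
  have hc2p : 0 < c2' := by positivity
  have hκ1 : κ ≤ 1 := by
    have t1 : 0 ≤ c2' * ((1 + δ) * B) ^ (2 * α) / (2 * α) := by positivity
    have t2 : 1 / (2 * α) ≤ 1 := by rw [div_le_one (by linarith)]; linarith
    linarith
  obtain ⟨Q0, hcore⟩ := core_ineq (p := 2 * α) (by linarith) hA (B := (1 + δ) * B)
    (by positivity) hc2p.le hκ hh1 hh2 (c2' * ((1 + δ) * C1)) (c2 * 2 ^ (2 * α))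
  obtain ⟨M, hM, hMp⟩ := hset Q0 δ hδ
  obtain ⟨ψ, Θ, p1, p2, p3, p4, p5, p6, p7, p8, p9⟩ := psi_setup hf (α := α) hA hM
    (fun t h1 h2 => (hMp t h1 h2).1)
  obtain ⟨D, hD0, hD⟩ := poly_ineq (p := 2 * α) (c := δ) (by linarith) hδ (Θ M) 
    (c2' * (B * f M))
  have hfM := hf.pos M (dom0_sub a hM)
  have hdM := fd_pos hf hM
  set E := M ^ (2 * α) * deriv f M ^ (α + 1 / 2) with hE
  have hE0 : 0 ≤ E := by have := hM.1; positivity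
  set C := E + D + δ * 2 ^ (2 * α) + c2' * (C1 * f M) with hC
  have hCge : D + δ * 2 ^ (2 * α) + c2' * (C1 * f M) ≤ C := by linarith
  have h2p : (0:ℝ) ≤ 2 ^ (2 * α) := by positivity
  have hCE : E ≤ C := by
    have : 0 ≤ δ * 2 ^ (2 * α) + c2' * (C1 * f M) := by positivity
    linarith
  refine ⟨M, c2, δ, κ, C, ψ, Θ, hM, hc2, hδ, hκ, p1, p2, p3, p4, p5, ?_, ?_⟩
  · intro t ht
    have hdp := fd_pos hf ht
    have hFp := ftil_pos hf ht
    have hq := Qf_pos hf ht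
    rcases le_total t M with h | h
    · have q1 : ftil f t ^ (2 * α) ≤ (t * deriv f t) ^ (2 * α) :=
        Real.rpow_le_rpow hFp.le (ftil_le hf ht) (by linarith)
      have q2 : ftil f t ^ (2 * α) / deriv f t ^ (α - 1 / 2) ≤ E := by
        rw [div_le_iff₀ (by positivity)]
        refine q1.trans ?_
        rw [Real.mul_rpow ht.1.le hdp.le]
        have e : deriv f t ^ (2 * α) = deriv f t ^ (α + 1 / 2) * deriv f t ^ (α - 1 / 2) := by
          rw [← Real.rpow_add hdp]; congr 1; ring
        rw [e, ← mul_assoc]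
        apply mul_le_mul_of_nonneg_right _ (by positivity)
        have := ht.1
        exact mul_le_mul (Real.rpow_le_rpow ht.1.le h (by linarith))
          (Real.rpow_le_rpow hdp.le (fd_mono hf ht hM h) (by linarith)) (by positivity)
          (Real.rpow_nonneg hM.1.le _)
      have : 0 ≤ √(deriv f t) * ψ t ^ 2 := by positivity
      linarith
    · have e : ftil f t ^ (2 * α) / deriv f t ^ (α - 1 / 2) = √(deriv f t) * ψ t ^ 2 := by
        rw [p8 t h ht.2, Qf_mul_sqrt hf ht, Real.mul_rpow (Real.sqrt_nonneg _) hq.le]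
        have : √(deriv f t) ^ (2 * α) = √(deriv f t) * deriv f t ^ (α - 1 / 2) := by
          rw [Real.sqrt_eq_rpow, ← Real.rpow_mul hdp.le, ← Real.rpow_add hdp]; congr 1; ring
        rw [this]
        have : 0 < deriv f t ^ (α - 1 / 2) := by positivity
        field_simp
      rw [e]; linarith
  · have key : ∀ t ∈ dom0 a, ∀ s, 0 ≤ s → Θ t * s + c2' * (G s * f t) +
        κ * (√(deriv f t) * ψ t ^ 2) ≤
        √(deriv f t) * ψ t ^ 2 + c2 * (√(deriv f t) * η s ^ 2) + δ * η s ^ 2 + C := by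
      intro t ht s hs
      have hρ := Real.sqrt_pos.2 (fd_pos hf ht)
      set ρ := √(deriv f t) with hρd
      have hft := hf.pos t (dom0_sub a ht)
      have a1 := hG s hs
      have a2 := hη s hs
      have a3 := hD s hs
      have hsp : 0 ≤ s ^ (2 * α - 1) := Real.rpow_nonneg hs _
      have a4 : δ * s ^ (2 * α) ≤ δ * η s ^ 2 + δ * 2 ^ (2 * α) := by nlinarith
      rcases le_total t M with h | h
      · have b1 : Θ t * s ≤ Θ M * s := mul_le_mul_of_nonneg_right (p7 t h) hs
        have b2 : G s * f t ≤ (C1 + B * s ^ (2 * α - 1)) * f M :=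
          mul_le_mul a1 (f_mono hf ht.1.le h hM.2) hft.le (by positivity)
        have b3 := mul_le_mul_of_nonneg_left b2 hc2p.le
        have b4 : κ * (ρ * ψ t ^ 2) ≤ ρ * ψ t ^ 2 :=
          mul_le_of_le_one_left (by positivity) hκ1
        have b5 : 0 ≤ c2 * (ρ * η s ^ 2) := by positivity
        linarith
      · obtain ⟨_, hQ, hfe⟩ := hMp t h ht.2
        have b0 := hcore (Qf f t) s hQ hs
        have b1 : Θ t * s ≤ (Θ M + A * (ρ * Qf f t ^ (2 * α - 1))) * s :=
          mul_le_mul_of_nonneg_right (p9 t h ht.2) hs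
        have hq := Qf_pos hf ht
        rw [Qf_mul_sqrt hf ht] at hfe
        have b2 : G s * f t ≤ (C1 + B * s ^ (2 * α - 1)) * ((1 + δ) * (ρ * Qf f t)) :=
          mul_le_mul a1 hfe hft.le (by positivity)
        have b3 := mul_le_mul_of_nonneg_left b2 hc2p.le
        have b4 := mul_le_mul_of_nonneg_left b0 hρ.le
        have b5 := mul_le_mul_of_nonneg_left a2 (mul_nonneg hc2.le hρ.le)
        have b6 : 0 ≤ c2' * (C1 * f M) := by positivity
        have b7 : 0 ≤ c2' * (B * f M) * s ^ (2 * α - 1) := by positivity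
        rw [p8 t h ht.2]
        linarith
    intro t ht s
    rcases le_total 0 s with h | h
    · exact key t ht s h
    · have := key t ht 0 le_rfl
      rw [hG0 0 (by norm_num), hη0 0 (by norm_num)] at this
      rw [hG0 s (by linarith), hη0 s (by linarith)]
      have := mul_nonpos_of_nonneg_of_nonpos (p6 t ht.2) h
      linarith

lemma main_one {n : ℕ} {Ω : Set (EE n)} (hΩ : GoodDomain Ω) (i : Fin n) 
    {a : EReal} {f : ℝ → ℝ} (hf : HypH a f) {R Λ : ℝ} (hR : ∀ x ∈ Ω, ‖x‖ ≤ R) 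
    {α M c2 δ κ C : ℝ} {ψ Θ η G : ℝ → ℝ}
    (hη : ∀ t, ContDiffAt ℝ (⊤ : ℕ∞) η t) (hη0 : ∀ t ≤ 1, η t = 0)
    (hG : ∀ t, ContDiffAt ℝ (⊤ : ℕ∞) G t) (hG0 : ∀ t ≤ 1, G t = 0)
    (hGd : ∀ t, deriv G t = (deriv η t) ^ 2) (hGn : ∀ t, 0 ≤ G t)
    (hM : M ∈ dom0 a) (hc2 : 0 < c2) (hδ : 0 < δ) (hκ : 0 < κ)
    (hψ : ∀ t : ℝ, (t : EReal) < a → ContDiffAt ℝ (⊤ : ℕ∞) ψ t) (hψ0 : ∀ t ≤ M / 2, ψ t = 0)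
    (hΘ : ∀ t : ℝ, (t : EReal) < a → ContDiffAt ℝ (⊤ : ℕ∞) Θ t) (hΘ0 : ∀ t ≤ M / 2, Θ t = 0)
    (hΘd : ∀ t : ℝ, (t : EReal) < a → deriv Θ t = (deriv ψ t) ^ 2)
    (hT : ∀ t ∈ dom0 a, ftil f t ^ (2 * α) / deriv f t ^ (α - 1 / 2) ≤
        √(deriv f t) * ψ t ^ 2 + C)
    (hP : ∀ t ∈ dom0 a, ∀ s, Θ t * s + (c2 + δ * (4 * R ^ 2 * Λ)) * (G s * f t) +
        κ * (√(deriv f t) * ψ t ^ 2) ≤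
        √(deriv f t) * ψ t ^ 2 + c2 * (√(deriv f t) * η s ^ 2) + δ * η s ^ 2 + C)
    {lam : ℝ} (hl : 0 < lam) (hΛ : √lam ≤ Λ) {u : EE n → ℝ} (hs : Solves Ω a lam f u)
    (hu : ∀ x ∈ Ω, 0 < u x) (hst : StabIneq Ω lam f u) :
    ∫ x in Ω, ftil f (u x) ^ (2 * α) / deriv f (u x) ^ (α - 1 / 2) ≤
      C * volume.real Ω / κ + C * volume.real Ω := by
  obtain ⟨ho, hb, -⟩ := hΩ
  obtain ⟨hus, hua, hpde, hu0, hlu0⟩ := hs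
  have hL := Real.sqrt_pos.2 hl
  set w : EE n → ℝ := fun x => (-(1 / √lam)) * lap u x with hw
  have hlw : ∀ x, - lap u x = √lam * w x := by intro x; simp only [hw]; field_simp
  have hlapc := contDiff_lap hus
  have hws : ContDiff ℝ (⊤ : ℕ∞) w := contDiff_const.mul hlapc
  have hwl : ∀ x ∈ Ω, - lap w x = √lam * f (u x) := by
    intro x hx
    rw [hw, lap_neg hlapc, hpde x hx]
    have : lam = √lam * √lam := (Real.mul_self_sqrt hl.le).symm
    field_simp
    rw [Real.sq_sqrt hl.le]
  have hud : ∀ x ∈ Ω, u x ∈ dom0 a := fun x hx => ⟨hu x hx, (hua x hx).2⟩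
  have hfru : ∀ x ∈ frontier Ω, u x < M / 2 := by
    intro x hx; rw [hu0 x hx]; linarith [hM.1]
  have hfrw : ∀ x ∈ frontier Ω, w x < 1 := by
    intro x hx; simp only [hw]; rw [hlu0 x hx]; norm_num
  -- continuity
  have cu := hus.continuous.continuousOn (s := Ω)
  have cw := hws.continuous.continuousOn (s := Ω)
  have comp : ∀ {h : ℝ → ℝ} {z : EE n → ℝ}, Continuous z →
      (∀ x ∈ Ω, ContDiffAt ℝ (⊤ : ℕ∞) h (z x)) → ContinuousOn (fun x => h (z x)) Ω :=
    fun hz hh x hx => (ContinuousAt.comp (hh x hx).continuousAt hz.continuousAt).continuousWithinAt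
  have cψ := comp hus.continuous (fun x hx => hψ _ (hud x hx).2)
  have cΘ := comp hus.continuous (fun x hx => hΘ _ (hud x hx).2)
  have cη := comp hws.continuous (fun x _ => hη (w x))
  have cG := comp hws.continuous (fun x _ => hG (w x))
  have cf := comp hus.continuous (fun x hx => f_contDiffAt hf (hud x hx))
  have cρ : ContinuousOn (fun x => √(deriv f (u x))) Ω :=
    (comp hus.continuous (fun x hx => contDiffAt_deriv (f_contDiffAt hf (hud x hx)))).sqrt
  -- integrability
  have i1 : IntegrableOn (fun x => √(deriv f (u x)) * ψ (u x) ^ 2) Ω :=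
    cut_integrable ho hb hus.continuous hfru (cρ.mul (cψ.pow 2))
      (fun x _ h => by rw [hψ0 _ h.le]; ring)
  have i2 : IntegrableOn (fun x => Θ (u x) * w x) Ω :=
    cut_integrable ho hb hus.continuous hfru (cΘ.mul cw)
      (fun x _ h => by rw [hΘ0 _ h.le]; ring)
  have i3 : IntegrableOn (fun x => G (w x) * f (u x)) Ω :=
    cut_integrable ho hb hws.continuous hfrw (cG.mul cf)
      (fun x _ h => by rw [hG0 _ h.le]; ring)
  have i4 : IntegrableOn (fun x => √(deriv f (u x)) * η (w x) ^ 2) Ω :=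
    cut_integrable ho hb hws.continuous hfrw (cρ.mul (cη.pow 2))
      (fun x _ h => by rw [hη0 _ h.le]; ring)
  have i5 : IntegrableOn (fun x => η (w x) ^ 2) Ω :=
    cut_integrable ho hb hws.continuous hfrw (cη.pow 2)
      (fun x _ h => by rw [hη0 _ h.le]; ring)
  have hvol : volume Ω ≠ ⊤ := hb.measure_lt_top.ne
  have i6 : IntegrableOn (fun _ : EE n => C) Ω := integrableOn_const hvol
  -- stability inequalities
  have s1 := stab_cut ho hb hst hus hfru (fun x hx => hψ _ (hud x hx).2) hψ0
    (fun x hx => hΘ _ (hud x hx).2) hΘ0 (fun x hx => hΘd _ (hud x hx).2)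
  have s2 := stab_cut ho hb hst hws hfrw (fun x _ => hη (w x)) hη0 (fun x _ => hG (w x)) hG0
    (fun x _ => hGd (w x))
  have s3 := poincare_cut i ho hb hR hws hfrw (fun x _ => hη (w x)) hη0 (fun x _ => hG (w x)) hG0
    (fun x _ => hGd (w x))
  have e1 : ∫ x in Ω, Θ (u x) * (- lap u x) = √lam * ∫ x in Ω, Θ (u x) * w x := by
    rw [← integral_const_mul]
    congr 1; ext x; rw [hlw]; ring
  have e2 : ∫ x in Ω, G (w x) * (- lap w x) = √lam * ∫ x in Ω, G (w x) * f (u x) := by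
    rw [← integral_const_mul]
    refine setIntegral_congr_fun ho.measurableSet (fun x hx => ?_)
    rw [hwl x hx]; ring
  rw [e1] at s1
  rw [e2] at s2 s3
  replace s1 := le_of_mul_le_mul_left s1 hL
  replace s2 := le_of_mul_le_mul_left s2 hL
  have hJ : 0 ≤ ∫ x in Ω, G (w x) * f (u x) :=
    setIntegral_nonneg ho.measurableSet
      (fun x hx => mul_nonneg (hGn _) (hf.pos _ (dom0_sub a (hud x hx))).le)
  have s4 : ∫ x in Ω, η (w x) ^ 2 ≤ 4 * R ^ 2 * Λ * ∫ x in Ω, G (w x) * f (u x) := by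
    refine s3.trans ?_
    rw [mul_assoc (4 * R ^ 2)]
    exact mul_le_mul_of_nonneg_left (mul_le_mul_of_nonneg_right hΛ hJ) (by positivity)
  have hint := setIntegral_mono_on (μ := volume) (s := Ω)
    (((i2.add (i3.const_mul (c2 + δ * (4 * R ^ 2 * Λ)))).add (i1.const_mul κ)))
    (((i1.add (i4.const_mul c2)).add (i5.const_mul δ)).add i6) ho.measurableSet
    (fun x hx => hP _ (hud x hx) (w x))
  rw [integral_add' (i2.add (i3.const_mul _)) (i1.const_mul κ),
    integral_add' i2 (i3.const_mul _),
    integral_add' ((i1.add (i4.const_mul c2)).add (i5.const_mul δ)) i6,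
    integral_add' (i1.add (i4.const_mul c2)) (i5.const_mul δ),
    integral_add' i1 (i4.const_mul c2), setIntegral_const] at hint
  simp only [integral_const_mul, smul_eq_mul] at hint
  have s5 := mul_le_mul_of_nonneg_left s2 hc2.le
  have s6 := mul_le_mul_of_nonneg_left s4 hδ.le
  have hX : ∫ x in Ω, √(deriv f (u x)) * ψ (u x) ^ 2 ≤ C * volume.real Ω / κ := by
    rw [le_div_iff₀ hκ]; linarith
  calc ∫ x in Ω, ftil f (u x) ^ (2 * α) / deriv f (u x) ^ (α - 1 / 2)
      ≤ ∫ x in Ω, (√(deriv f (u x)) * ψ (u x) ^ 2 + C) := by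
        refine integral_mono_of_nonneg ?_ (i1.add i6) ?_
        · filter_upwards [ae_restrict_mem ho.measurableSet] with x hx
          have := ftil_pos hf (hud x hx)
          have := fd_pos hf (hud x hx)
          simp only [Pi.zero_apply]; positivity
        · filter_upwards [ae_restrict_mem ho.measurableSet] with x hx
          exact hT _ (hud x hx)
    _ = (∫ x in Ω, √(deriv f (u x)) * ψ (u x) ^ 2) + C * volume.real Ω := by
        rw [integral_add i1 i6, setIntegral_const, smul_eq_mul, mul_comm C]
    _ ≤ _ := by linarith

/-- **Claim (3.7).** Under (H) with `0 < τ₋ ≤ τ₊ < 2`, if `α > 1` satisfies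
`P_f(α, τ₋, τ₊) < 0` and `(u_m)` is a sequence of smooth positive solutions of `(N_{λ_m})`
satisfying the stability inequality, then `∫_Ω f̃(u_m)^{2α}/f'(u_m)^{α−1/2}` is uniformly
bounded. -/
theorem statement16 {n : ℕ} (Ω : Set (EuclideanSpace ℝ (Fin n))) (hΩ : GoodDomain Ω)
    (a : EReal) (f : ℝ → ℝ) (hf : HypH a f)
    (hτm : 0 < tauMinus a f) (hττ : tauMinus a f ≤ tauPlus a f) (hτp : tauPlus a f < 2)
    (α : ℝ) (hα : 1 < α) (hPα : Pf (tauMinus a f) (tauPlus a f) α < 0)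
    (lam : ℕ → ℝ) (hlam : ∀ m, 0 < lam m)
    (u : ℕ → EuclideanSpace ℝ (Fin n) → ℝ)
    (hsol : ∀ m, Solves Ω a (lam m) f (u m))
    (hupos : ∀ m, ∀ x ∈ Ω, 0 < u m x)
    (hstab : ∀ m, StabIneq Ω (lam m) f (u m)) :
    ∃ C : ℝ, ∀ m,
      ∫ x in Ω, ftil f (u m x) ^ (2 * α) / deriv f (u m x) ^ (α - 1 / 2) ≤ C := by
  have hn := n_pos hΩ hf (hlam 0) (hsol 0)
  obtain ⟨Λ0, hΛ0⟩ := lam_bound hΩ hf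
  obtain ⟨R, hR⟩ := hΩ.2.1.exists_norm_le
  set Λ := max Λ0 0 with hΛ
  have hΛp : 0 ≤ Λ := le_max_right _ _
  obtain ⟨η, G, C1, hC1, y1, y2, y3, y4, y5, y6, y7, y8⟩ := eta_setup hα
  obtain ⟨M, c2, δ, κ, C, ψ, Θ, hM, hc2, hδ, hκ, z1, z2, z3, z4, z5, z6, z7⟩ :=
    pointwise_setup hf hτm hττ hτp hα hPα (K := 4 * R ^ 2 * Λ) (by positivity) hC1 y2 y4 y6 y7 y8
  refine ⟨C * volume.real Ω / κ + C * volume.real Ω, fun m => ?_⟩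
  exact main_one hΩ ⟨0, hn⟩ hf hR y1 y2 y3 y4 y5 y6 hM hc2 hδ hκ z1 z2 z3 z4 z5 z6 z7 (hlam m)
    ((hΛ0 _ _ (hlam m) (hsol m) (hupos m) (hstab m)).trans (le_max_left _ _)) (hsol m)
    (hupos m) (hstab m)

end
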